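/- arXiv:1905.11326 — 8 statements merged into one kernel-verified Lean document; each statement's English description precedes it below -/
import Mathlib

section
/- Let σ be a generator of Gal(F_{q^m}/F_q) and let C ⊆ F_{q^m}^n be an F_{q^m}-linear code. Then s_i^σ(C) = s_{i+1}^σ(C) if and only if S_i^σ(C) has a basis of vectors all of whose entries lie in F_q, i.e., S_i^σ(C) is spanned over F_{q^m} by vectors in F_q^n. -/
open Module

section RankMetricDefs

variable {F K : Type} [Field F] [Field K] [Algebra F K]

/-- Entrywise application of a ring automorphism of `K` to vectors in `K^n`,
as a semilinear map. -/
def entrywiseMap (n : ℕ) (σ : K ≃+* K) :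
    (Fin n → K) →ₛₗ[(σ : K →+* K)] (Fin n → K) where
  toFun v := fun j => σ (v j)
  map_add' u v := by funext j; simp
  map_smul' c v := by funext j; simp [smul_eq_mul]

instance (σ : K ≃+* K) : RingHomSurjective ((σ : K →+* K)) := ⟨σ.surjective⟩

/-- The image `σ(C)` of a code `C ⊆ K^n` under entrywise application of a
ring automorphism `σ` of `K`. -/
def codeMap {n : ℕ} (σ : K ≃+* K) (C : Submodule K (Fin n → K)) :
    Submodule K (Fin n → K) :=
  Submodule.map (entrywiseMap n σ) C

/-- `S_i^σ(C) = C + σ(C) + … + σ^i(C)`. -/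
def Sseq {n : ℕ} (σ : K ≃ₐ[F] K) (C : Submodule K (Fin n → K)) (i : ℕ) :
    Submodule K (Fin n → K) :=
  (Finset.range (i + 1)).sup fun j => codeMap ((σ ^ j : K ≃ₐ[F] K) : K ≃+* K) C

/-- `s_i^σ(C) = dim_K S_i^σ(C)`. -/
noncomputable def sseq {n : ℕ} (σ : K ≃ₐ[F] K) (C : Submodule K (Fin n → K)) (i : ℕ) : ℕ :=
  Module.finrank K (Sseq σ C i)

/-- Semilinear equivalence of rank-metric codes: `C' = θ(C)·A` for a field
automorphism `θ` of `K` and an invertible matrix `A` with entries in (the image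
of) `F`. -/
def SemilinEquiv (F : Type) [Field F] {K : Type} [Field K] [Algebra F K] {n : ℕ}
    (C C' : Submodule K (Fin n → K)) : Prop :=
  ∃ (θ : K ≃+* K) (A : Matrix (Fin n) (Fin n) K),
    (∀ i j, A i j ∈ Set.range (algebraMap F K)) ∧ IsUnit A ∧
    (C' : Set (Fin n → K)) =
      (fun v => Matrix.vecMul (fun j => θ (v j)) A) '' (C : Set (Fin n → K))

/-- The Gabidulin code `G_k^σ(α) = ⟨α, σ(α), …, σ^{k-1}(α)⟩_K`. -/
def Gab {n : ℕ} (σ : K ≃ₐ[F] K) (k : ℕ) (α : Fin n → K) : Submodule K (Fin n → K) :=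
  Submodule.span K {v | ∃ j < k, v = fun x => (σ ^ j) (α x)}

/-- Sheekey's twisted Gabidulin code
`H_{k,η}^σ(α) = ⟨α + η·σ^k(α), σ(α), …, σ^{k-1}(α)⟩_K`. -/
def TGab {n : ℕ} (σ : K ≃ₐ[F] K) (k : ℕ) (η : K) (α : Fin n → K) :
    Submodule K (Fin n → K) :=
  Submodule.span K
    (insert (fun x => α x + η * (σ ^ k) (α x))
      {v | ∃ j, 1 ≤ j ∧ j < k ∧ v = fun x => (σ ^ j) (α x)})

end RankMetricDefs

section

variable {F K : Type} [Field F] [Field K] [Algebra F K] {n : ℕ}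

theorem codeMap_le_iff (τ : K ≃ₐ[F] K) (C S : Submodule K (Fin n → K)) :
    codeMap (τ : K ≃+* K) C ≤ S ↔ ∀ v ∈ C, (fun x => τ (v x)) ∈ S := by
  rw [codeMap, Submodule.map_le_iff_le_comap]
  rfl

theorem apply_mem_codeMap (τ : K ≃ₐ[F] K) {C : Submodule K (Fin n → K)} {v : Fin n → K}
    (hv : v ∈ C) : (fun x => τ (v x)) ∈ codeMap (τ : K ≃+* K) C :=
  (codeMap_le_iff τ C _).1 le_rfl v hv

theorem codeMap_pow_le_Sseq (σ : K ≃ₐ[F] K) (C : Submodule K (Fin n → K)) {i j : ℕ}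
    (hj : j ≤ i) : codeMap ((σ ^ j : K ≃ₐ[F] K) : K ≃+* K) C ≤ Sseq σ C i :=
  Finset.le_sup (f := fun j => codeMap ((σ ^ j : K ≃ₐ[F] K) : K ≃+* K) C)
    (Finset.mem_range.2 (Nat.lt_succ_of_le hj))

theorem Sseq_le_iff (σ : K ≃ₐ[F] K) (C S : Submodule K (Fin n → K)) (i : ℕ) :
    Sseq σ C i ≤ S ↔ ∀ j ≤ i, codeMap ((σ ^ j : K ≃ₐ[F] K) : K ≃+* K) C ≤ S := by
  simp [Sseq, Finset.sup_le_iff]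

theorem Sseq_le_succ (σ : K ≃ₐ[F] K) (C : Submodule K (Fin n → K)) (i : ℕ) :
    Sseq σ C i ≤ Sseq σ C (i + 1) :=
  (Sseq_le_iff σ C _ i).2 fun _ hj => codeMap_pow_le_Sseq σ C (hj.trans i.le_succ)

theorem codeMap_Sseq_le (σ : K ≃ₐ[F] K) (C : Submodule K (Fin n → K)) (i : ℕ) :
    codeMap (σ : K ≃+* K) (Sseq σ C i) ≤ Sseq σ C (i + 1) := by
  rw [codeMap, Submodule.map_le_iff_le_comap, Sseq_le_iff]
  intro j hj
  rw [codeMap_le_iff]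
  intro v hv
  have h := codeMap_pow_le_Sseq σ C (Nat.succ_le_succ hj) (apply_mem_codeMap (σ ^ (j + 1)) hv)
  rw [pow_succ'] at h
  exact h

/-- The sums `S_i` stabilize at step `i` exactly when `S_i` is invariant under `σ`. -/
theorem sseq_eq_succ_iff_codeMap_le (σ : K ≃ₐ[F] K) (C : Submodule K (Fin n → K)) (i : ℕ) :
    sseq σ C i = sseq σ C (i + 1) ↔ codeMap (σ : K ≃+* K) (Sseq σ C i) ≤ Sseq σ C i := by
  constructor
  · intro h
    exact (codeMap_Sseq_le σ C i).trans
      (Submodule.eq_of_le_of_finrank_eq (Sseq_le_succ σ C i) h).ge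
  · intro h
    refine congrArg (fun S : Submodule K (Fin n → K) => finrank K S)
      (le_antisymm (Sseq_le_succ σ C i) ((Sseq_le_iff σ C _ _).2 fun j hj => ?_))
    rcases Nat.le_succ_iff.1 hj with hj | rfl
    · exact codeMap_pow_le_Sseq σ C hj
    · rw [codeMap_le_iff] at h ⊢
      intro v hv
      rw [pow_succ']
      exact h _ (codeMap_pow_le_Sseq σ C le_rfl (apply_mem_codeMap (σ ^ i) hv))

theorem codeMap_span_le_of_base_field (τ : K ≃ₐ[F] K) {B : Set (Fin n → K)}
    (hB : ∀ v ∈ B, ∀ x, v x ∈ Set.range (algebraMap F K)) :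
    codeMap (τ : K ≃+* K) (Submodule.span K B) ≤ Submodule.span K B := by
  rw [codeMap, Submodule.map_le_iff_le_comap, Submodule.span_le]
  intro v hv
  have h : entrywiseMap n (τ : K ≃+* K) v = v := by
    funext x
    obtain ⟨a, ha⟩ := hB v hv x
    change τ (v x) = v x
    rw [← ha, τ.commutes]
  change entrywiseMap n (τ : K ≃+* K) v ∈ Submodule.span K B
  rw [h]
  exact Submodule.subset_span hv

theorem codeMap_pow_le_self {σ : K ≃ₐ[F] K} {S : Submodule K (Fin n → K)}
    (h : codeMap (σ : K ≃+* K) S ≤ S) (k : ℕ) :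
    codeMap ((σ ^ k : K ≃ₐ[F] K) : K ≃+* K) S ≤ S := by
  rw [codeMap_le_iff] at h ⊢
  induction k with
  | zero => exact fun v hv => hv
  | succ k ih =>
    intro v hv
    rw [pow_succ']
    exact h _ (ih v hv)

/-- Galois descent for subspaces of `K^n`: a Galois-invariant subspace is spanned by its vectors
with entries in the base field. -/
theorem span_base_field_eq_of_forall_codeMap_le [FiniteDimensional F K] [IsGalois F K]
    {S : Submodule K (Fin n → K)} (hS : ∀ τ : K ≃ₐ[F] K, codeMap (τ : K ≃+* K) S ≤ S) :
    Submodule.span K {v | v ∈ S ∧ ∀ x, v x ∈ Set.range (algebraMap F K)} = S := by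
  refine le_antisymm (Submodule.span_le.2 fun v hv => hv.1) fun v hv => ?_
  by_contra hvB
  obtain ⟨f, hf, hker⟩ := Submodule.exists_le_ker_of_notMem hvB
  have htrace (c : K) : ∑ τ : K ≃ₐ[F] K, τ c • (fun x => τ (v x)) ∈
      Submodule.span K {v | v ∈ S ∧ ∀ x, v x ∈ Set.range (algebraMap F K)} := by
    refine Submodule.subset_span ⟨S.sum_mem fun τ _ => S.smul_mem _
      ((codeMap_le_iff τ S S).1 (hS τ) v hv), fun x => ⟨Algebra.trace F K (c * v x), ?_⟩⟩
    rw [trace_eq_sum_automorphisms]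
    simp
  have hsum (c : K) : ∑ τ : K ≃ₐ[F] K, f (fun x => τ (v x)) * τ c = 0 := by
    have h := LinearMap.mem_ker.1 (hker (htrace c))
    simpa [mul_comm] using h
  have hind : LinearIndependent K (fun τ : K ≃ₐ[F] K => (τ : K → K)) :=
    (linearIndependent_monoidHom K K).comp (fun τ : K ≃ₐ[F] K => (τ : K →* K))
      fun τ τ' h => AlgEquiv.ext fun x => DFunLike.congr_fun h x
  refine hf (Fintype.linearIndependent_iff.1 hind (fun τ => f fun x => τ (v x)) ?_ 1)
  funext c
  simpa using hsum c

end

/-- `s_i^σ(C) = s_{i+1}^σ(C)` iff `S_i^σ(C)` is spanned over `K`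
by vectors all of whose entries lie in (the image of) `F`. -/
theorem sseq_stationary_iff_basis_over_base_field
    {F K : Type} [Field F] [Field K] [Algebra F K] [Fintype F] [Fintype K]
    (m : ℕ) (hm : Module.finrank F K = m)
    (σ : K ≃ₐ[F] K) (hσ : ∀ τ : K ≃ₐ[F] K, τ ∈ Subgroup.zpowers σ)
    (n : ℕ) (C : Submodule K (Fin n → K)) (i : ℕ) :
    sseq σ C i = sseq σ C (i + 1) ↔
      ∃ B : Set (Fin n → K),
        (∀ v ∈ B, ∀ x, v x ∈ Set.range (algebraMap F K)) ∧
        Submodule.span K B = Sseq σ C i := by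
  rw [sseq_eq_succ_iff_codeMap_le]
  constructor
  · intro h
    refine ⟨_, fun v hv => hv.2, span_base_field_eq_of_forall_codeMap_le (F := F) fun τ => ?_⟩
    obtain ⟨k, rfl⟩ := mem_powers_iff_mem_zpowers.2 (hσ τ)
    exact codeMap_pow_le_self h k
  · rintro ⟨B, hB, hspan⟩
    rw [← hspan]
    exact codeMap_span_le_of_base_field σ hB
end

section
/- Let σ be a generator of Gal(F_{q^m}/F_q) and let C ⊆ F_{q^m}^n be an F_{q^m}-linear code. Then for all integers i, j ≥ 0, s_{i+j+1}^σ(C) − s_{i+j}^σ(C) ≤ s_{i+1}^σ(C) − s_i^σ(C); i.e., the increments of the dimension sequence are non-increasing. -/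
open Module

section SseqIncrements

variable {F K : Type} [Field F] [Field K] [Algebra F K] {n : ℕ}

theorem entrywiseMap_injective (σ : K ≃+* K) : Function.Injective (entrywiseMap n σ) :=
  fun _ _ h => funext fun j => σ.injective (congrFun h j)

theorem finrank_codeMap (σ : K ≃+* K) (C : Submodule K (Fin n → K)) :
    finrank K (codeMap σ C) = finrank K C := by
  have := RingHomInvPair.of_ringEquiv σ
  have := RingHomInvPair.of_ringEquiv_symm σ
  let e : C ≃ₛₗ[(σ : K →+* K)] codeMap σ C :=
    Submodule.equivMapOfInjective (σ₂₁ := (σ.symm : K →+* K)) (entrywiseMap n σ)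
      (entrywiseMap_injective σ) C
  exact congrArg Cardinal.toNat
    (rank_eq_of_equiv_equiv σ e.toAddEquiv σ.bijective fun r x => e.map_smulₛₗ r x).symm

theorem codeMap_sup (σ : K ≃+* K) (C D : Submodule K (Fin n → K)) :
    codeMap σ (C ⊔ D) = codeMap σ C ⊔ codeMap σ D :=
  Submodule.map_sup C D _

theorem codeMap_codeMap_pow (σ : K ≃ₐ[F] K) (j : ℕ) (C : Submodule K (Fin n → K)) :
    codeMap (σ : K ≃+* K) (codeMap ((σ ^ j : K ≃ₐ[F] K) : K ≃+* K) C) =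
      codeMap ((σ ^ (j + 1) : K ≃ₐ[F] K) : K ≃+* K) C := by
  ext v
  simp only [codeMap, Submodule.mem_map, exists_exists_and_eq_and]
  refine exists_congr fun w => and_congr_right fun _ => ?_
  rw [pow_succ']
  rfl

theorem Sseq_succ (σ : K ≃ₐ[F] K) (C : Submodule K (Fin n → K)) (i : ℕ) :
    Sseq σ C (i + 1) = Sseq σ C i ⊔ codeMap ((σ ^ (i + 1) : K ≃ₐ[F] K) : K ≃+* K) C := by
  rw [Sseq, Finset.range_add_one, Finset.sup_insert, sup_comm]
  rfl

theorem Sseq_mono (σ : K ≃ₐ[F] K) (C : Submodule K (Fin n → K)) : Monotone (Sseq σ C) :=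
  monotone_nat_of_le_succ fun i => Sseq_succ σ C i ▸ le_sup_left

theorem codeMap_Sseq_sup (σ : K ≃ₐ[F] K) (C : Submodule K (Fin n → K)) (i : ℕ) :
    Sseq σ C i ⊔ codeMap (σ : K ≃+* K) (Sseq σ C i) = Sseq σ C (i + 1) := by
  induction i with
  | zero =>
    rw [Sseq_succ, ← codeMap_codeMap_pow]
    simp [Sseq]
  | succ i ih =>
    have h : codeMap (σ : K ≃+* K) (Sseq σ C i) ≤ Sseq σ C (i + 1) := ih ▸ le_sup_right
    conv_lhs => rw [Sseq_succ σ C i, codeMap_sup, codeMap_codeMap_pow, ← Sseq_succ, ← sup_assoc]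
    rw [sup_eq_left.mpr h, ← Sseq_succ]

theorem sseq_succ_succ_add_le (σ : K ≃ₐ[F] K) (C : Submodule K (Fin n → K)) (i : ℕ) :
    sseq σ C (i + 1 + 1) + sseq σ C i ≤ sseq σ C (i + 1) + sseq σ C (i + 1) := by
  have h := Submodule.finrank_sup_add_finrank_inf_eq (Sseq σ C (i + 1))
    (codeMap (σ : K ≃+* K) (Sseq σ C (i + 1)))
  rw [codeMap_Sseq_sup, finrank_codeMap] at h
  have hle : codeMap (σ : K ≃+* K) (Sseq σ C i) ≤
      Sseq σ C (i + 1) ⊓ codeMap (σ : K ≃+* K) (Sseq σ C (i + 1)) :=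
    le_inf (codeMap_Sseq_sup σ C i ▸ le_sup_right)
      (Submodule.map_mono (Sseq_mono σ C i.le_succ))
  have hrank := Submodule.finrank_mono hle
  rw [finrank_codeMap] at hrank
  simp only [sseq]
  omega

theorem antitone_sseq_increments (σ : K ≃ₐ[F] K) (C : Submodule K (Fin n → K)) :
    Antitone fun i => sseq σ C (i + 1) - sseq σ C i :=
  antitone_nat_of_succ_le fun i => by
    have := sseq_succ_succ_add_le σ C i
    omega

end SseqIncrements

/-- the increments of the sequence `(s_i^σ(C))_i` are
non-increasing: `s_{i+j+1}^σ(C) − s_{i+j}^σ(C) ≤ s_{i+1}^σ(C) − s_i^σ(C)`. -/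
theorem sseq_increments_nonincreasing
    {F K : Type} [Field F] [Field K] [Algebra F K] [Fintype F] [Fintype K]
    (m : ℕ) (hm : Module.finrank F K = m)
    (σ : K ≃ₐ[F] K) (hσ : ∀ τ : K ≃ₐ[F] K, τ ∈ Subgroup.zpowers σ)
    (n : ℕ) (C : Submodule K (Fin n → K)) :
    ∀ i j : ℕ,
      sseq σ C (i + j + 1) - sseq σ C (i + j) ≤ sseq σ C (i + 1) - sseq σ C i := by
  exact fun i j => antitone_sseq_increments σ C (Nat.le_add_right i j)
end

section
/- Let C = G_k^σ(α) be a Gabidulin code of length n and dimension k, and let 0 ≤ ℓ ≤ k and i ≥ 0 be integers. Then S_i^{σ^ℓ}(C) equals the F_{q^m}-span of {α, σ(α), …, σ^{k+iℓ−1}(α)} (i.e., the Gabidulin code G_{k+iℓ}^σ(α), powers of σ taken in Gal(F_{q^m}/F_q)), and s_i^{σ^ℓ}(C) = min{k+iℓ, n}. -/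
open Module

section Gabidulin

variable {F K : Type} [Field F] [Field K] [Algebra F K] {n : ℕ}

/-- The vectors conjugate to an `F`-independent vector span `K^n` when `K/F` is Galois. -/
theorem span_conjugates_eq_top [FiniteDimensional F K] [IsGalois F K] {α : Fin n → K}
    (hα : LinearIndependent F α) :
    Submodule.span K (Set.range fun τ : K ≃ₐ[F] K => fun x => τ (α x)) = ⊤ := by
  by_contra hne
  obtain ⟨f, hf0, hf⟩ := Submodule.exists_le_ker_of_lt_top _ (lt_top_iff_ne_top.mpr hne)
  have horth (τ : K ≃ₐ[F] K) : ∑ x, α x * τ (f (Pi.single x 1)) = 0 := by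
    have h : f (fun x => τ⁻¹ (α x)) = 0 := hf (Submodule.subset_span ⟨τ⁻¹, rfl⟩)
    rw [LinearMap.pi_apply_eq_sum_univ] at h
    have hsingle (x : Fin n) : (fun j => if x = j then (1 : K) else 0) = Pi.single x 1 := by
      funext j
      simp [Pi.single_apply, eq_comm]
    simp_rw [hsingle] at h
    have h' := congrArg τ h
    simpa only [map_sum, smul_eq_mul, map_mul, map_zero, AlgEquiv.aut_inv,
      AlgEquiv.apply_symm_apply] using h'
  have htr (l : K) (x : Fin n) : Algebra.trace F K (l * f (Pi.single x 1)) = 0 := by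
    refine Fintype.linearIndependent_iff.mp hα
      (fun x => Algebra.trace F K (l * f (Pi.single x 1))) ?_ x
    calc ∑ x, Algebra.trace F K (l * f (Pi.single x 1)) • α x
        = ∑ x, ∑ τ : K ≃ₐ[F] K, τ l * (α x * τ (f (Pi.single x 1))) := by
          refine Finset.sum_congr rfl fun x _ => ?_
          rw [Algebra.smul_def, trace_eq_sum_automorphisms, Finset.sum_mul]
          exact Finset.sum_congr rfl fun τ _ => by rw [map_mul]; ring
      _ = 0 := by
          rw [Finset.sum_comm]
          simp [← Finset.mul_sum, horth]
  refine hf0 (LinearMap.pi_ext' fun x => LinearMap.ext_ring ?_)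
  refine (traceForm_nondegenerate F K).1 _ fun l => ?_
  simpa [Algebra.traceForm_apply, mul_comm] using htr l x

theorem pow_apply_mem_Gab (σ : K ≃ₐ[F] K) {k j : ℕ} (hj : j < k) (α : Fin n → K) :
    (fun x => (σ ^ j) (α x)) ∈ Gab σ k α :=
  Submodule.subset_span ⟨j, hj, rfl⟩

theorem Gab_mono (σ : K ≃ₐ[F] K) (α : Fin n → K) : Monotone fun k => Gab σ k α :=
  fun _ _ h => Submodule.span_mono fun _ ⟨j, hj, hv⟩ => ⟨j, hj.trans_le h, hv⟩

/-- If `σ^k(α)` already lies in `G_k^σ(α)`, then so do all the vectors `σ^j(α)`. -/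
theorem pow_apply_mem_Gab_of_mem {σ : K ≃ₐ[F] K} {k : ℕ} {α : Fin n → K}
    (h : (fun x => (σ ^ k) (α x)) ∈ Gab σ k α) (j : ℕ) :
    (fun x => (σ ^ j) (α x)) ∈ Gab σ k α := by
  have hstable : Gab σ k α ≤ (Gab σ k α).comap (entrywiseMap n (σ : K ≃+* K)) := by
    refine Submodule.span_le.mpr ?_
    rintro _ ⟨t, ht, rfl⟩
    have heq : entrywiseMap n (σ : K ≃+* K) (fun x => (σ ^ t) (α x)) =
        fun x => (σ ^ (t + 1)) (α x) := by
      funext x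
      rw [pow_succ']
      rfl
    rw [SetLike.mem_coe, Submodule.mem_comap, heq]
    rcases (Nat.succ_le_of_lt ht).lt_or_eq with ht' | ht'
    · exact pow_apply_mem_Gab σ ht' α
    · rwa [← ht'] at h ⊢
  induction j with
  | zero =>
    rcases Nat.eq_zero_or_pos k with rfl | hk
    · exact h
    · exact pow_apply_mem_Gab σ hk α
  | succ j ih =>
    have := hstable ih
    rw [Submodule.mem_comap] at this
    convert this using 1
    funext x
    rw [pow_succ']
    rfl

theorem finrank_Gab_le (σ : K ≃ₐ[F] K) (k : ℕ) (α : Fin n → K) :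
    finrank K (Gab σ k α) ≤ k := by
  have hset : {v | ∃ j < k, v = fun x => (σ ^ j) (α x)} =
      Set.range fun j : Fin k => fun x => (σ ^ (j : ℕ)) (α x) := by
    ext v
    exact ⟨fun ⟨j, hj, hv⟩ => ⟨⟨j, hj⟩, hv.symm⟩, fun ⟨j, hv⟩ => ⟨j, j.2, hv.symm⟩⟩
  rw [Gab, hset]
  exact (finrank_range_le_card (R := K)
    fun j : Fin k => fun x => (σ ^ (j : ℕ)) (α x)).trans_eq (Fintype.card_fin k)

theorem le_finrank_Gab [FiniteDimensional F K] [IsGalois F K] {σ : K ≃ₐ[F] K}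
    (hσ : ∀ τ : K ≃ₐ[F] K, τ ∈ Subgroup.zpowers σ) {α : Fin n → K}
    (hα : LinearIndependent F α) {k : ℕ} (hk : k ≤ n) : k ≤ finrank K (Gab σ k α) := by
  induction k with
  | zero => exact Nat.zero_le _
  | succ k ih =>
    by_cases hmem : (fun x => (σ ^ k) (α x)) ∈ Gab σ k α
    · have htop : Gab σ k α = ⊤ := by
        rw [← top_le_iff, ← span_conjugates_eq_top hα, Submodule.span_le]
        rintro _ ⟨τ, rfl⟩
        obtain ⟨j, rfl⟩ := mem_powers_iff_mem_zpowers.mpr (hσ τ)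
        exact pow_apply_mem_Gab_of_mem hmem j
      have htop' : Gab σ (k + 1) α = ⊤ := top_le_iff.mp (htop ▸ Gab_mono σ α k.le_succ)
      rw [htop', finrank_top, Module.finrank_fin_fun]
      exact hk
    · have hlt : Gab σ k α < Gab σ (k + 1) α :=
        lt_of_le_of_ne (Gab_mono σ α k.le_succ)
          fun h => hmem (h ▸ pow_apply_mem_Gab σ k.lt_succ_self α)
      exact (ih (Nat.le_of_succ_le hk)).trans_lt (Submodule.finrank_lt_finrank_of_lt hlt)

theorem finrank_Gab [FiniteDimensional F K] [IsGalois F K] {σ : K ≃ₐ[F] K}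
    (hσ : ∀ τ : K ≃ₐ[F] K, τ ∈ Subgroup.zpowers σ) {α : Fin n → K}
    (hα : LinearIndependent F α) (k : ℕ) : finrank K (Gab σ k α) = min k n := by
  refine le_antisymm (le_min (finrank_Gab_le σ k α) ?_) ?_
  · simpa using Submodule.finrank_le (Gab σ k α)
  · exact (le_finrank_Gab hσ hα (min_le_right k n)).trans
      (Submodule.finrank_mono (Gab_mono σ α (min_le_left k n)))

theorem entrywiseMap_pow_apply (σ : K ≃ₐ[F] K) (ℓ j t : ℕ) (α : Fin n → K) :
    entrywiseMap n (((σ ^ ℓ) ^ j : K ≃ₐ[F] K) : K ≃+* K) (fun x => (σ ^ t) (α x)) =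
      fun x => (σ ^ (j * ℓ + t)) (α x) := by
  funext x
  rw [pow_add, mul_comm j, pow_mul]
  rfl

theorem Sseq_pow_Gab (σ : K ≃ₐ[F] K) (α : Fin n → K) {k ℓ : ℕ} (hℓ : ℓ ≤ k) (i : ℕ) :
    Sseq (σ ^ ℓ) (Gab σ k α) i = Gab σ (k + i * ℓ) α := by
  apply le_antisymm
  · refine Finset.sup_le fun j hj => Submodule.map_le_iff_le_comap.mpr ?_
    refine Submodule.span_le.mpr ?_
    rintro _ ⟨t, ht, rfl⟩
    rw [SetLike.mem_coe, Submodule.mem_comap, entrywiseMap_pow_apply]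
    have hji : j * ℓ ≤ i * ℓ :=
      Nat.mul_le_mul_right ℓ (Nat.lt_succ_iff.mp (Finset.mem_range.mp hj))
    exact pow_apply_mem_Gab σ (by omega) α
  · refine Submodule.span_le.mpr ?_
    rintro _ ⟨s, hs, rfl⟩
    obtain ⟨j, hj, t, ht, rfl⟩ : ∃ j ≤ i, ∃ t < k, s = j * ℓ + t := by
      rcases lt_or_ge s (i * ℓ) with h | h
      · have hpos : 0 < ℓ := Nat.pos_of_ne_zero fun h0 => by simp [h0] at h
        exact ⟨s / ℓ, ((Nat.div_lt_iff_lt_mul hpos).mpr h).le, s % ℓ,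
          (Nat.mod_lt s hpos).trans_le hℓ, (Nat.div_add_mod' s ℓ).symm⟩
      · exact ⟨i, le_rfl, s - i * ℓ, by omega, by omega⟩
    rw [← entrywiseMap_pow_apply]
    exact Finset.le_sup (f := fun j => codeMap (((σ ^ ℓ) ^ j : K ≃ₐ[F] K) : K ≃+* K) (Gab σ k α))
      (Finset.mem_range.mpr (Nat.lt_succ_of_le hj))
      (Submodule.mem_map_of_mem (pow_apply_mem_Gab σ ht α))

end Gabidulin

/-- for a Gabidulin code `C = G_k^σ(α)` and `0 ≤ ℓ ≤ k`,
`S_i^{σ^ℓ}(C) = G_{k+iℓ}^σ(α)` and `s_i^{σ^ℓ}(C) = min{k+iℓ, n}`. -/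
theorem gabidulin_sseq_small_power
    {F K : Type} [Field F] [Field K] [Algebra F K] [Fintype F] [Fintype K]
    (m : ℕ) (hm : Module.finrank F K = m)
    (σ : K ≃ₐ[F] K) (hσ : ∀ τ : K ≃ₐ[F] K, τ ∈ Subgroup.zpowers σ)
    (n k : ℕ) (hk1 : 1 ≤ k) (hkn : k ≤ n) (hnm : n ≤ m)
    (α : Fin n → K) (hα : LinearIndependent F α)
    (C : Submodule K (Fin n → K)) (hC : C = Gab σ k α)
    (ℓ : ℕ) (hℓ : ℓ ≤ k) (i : ℕ) :
    Sseq (σ ^ ℓ) C i = Gab σ (k + i * ℓ) α ∧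
    sseq (σ ^ ℓ) C i = min (k + i * ℓ) n := by
  subst hC
  have hS := Sseq_pow_Gab σ α hℓ i
  exact ⟨hS, by rw [sseq, hS, finrank_Gab hσ hα]⟩
end

section
/- Let C = G_k^σ(α) be a Gabidulin code of length n and dimension k, and let m−k ≤ ℓ ≤ m−1 and i ≥ 0 be integers. Then S_i^{σ^ℓ}(C) equals the F_{q^m}-span of {σ^{k−1}(α), σ^{k−2}(α), …, σ^{k−(k+i(m−ℓ))}(α)} (i.e., the Gabidulin code G_{k+i(m−ℓ)}^{σ^{-1}}(σ^{k−1}(α)), where powers of σ are taken in the cyclic group Gal(F_{q^m}/F_q), so negative exponents are interpreted modulo m), and s_i^{σ^ℓ}(C) = min{k+i(m−ℓ), n}. -/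
open Module

section GabidulinLemmas

variable {F K : Type} [Field F] [Field K] [Algebra F K] {n : ℕ}

theorem codeMap_Gab (ρ : K ≃+* K) (σ : K ≃ₐ[F] K) (k : ℕ) (α : Fin n → K) :
    codeMap ρ (Gab σ k α) =
      Submodule.span K {v | ∃ j < k, v = fun x => ρ ((σ ^ j) (α x))} := by
  rw [codeMap, Gab, Submodule.map_span]
  congr 1
  ext v
  constructor
  · rintro ⟨_, ⟨j, hj, rfl⟩, rfl⟩
    exact ⟨j, hj, rfl⟩
  · rintro ⟨j, hj, rfl⟩
    exact ⟨_, ⟨j, hj, rfl⟩, rfl⟩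

theorem mem_Gab (σ : K ≃ₐ[F] K) {j k : ℕ} (hj : j < k) (α : Fin n → K) :
    (fun x => (σ ^ j) (α x)) ∈ Gab σ k α :=
  Submodule.subset_span ⟨j, hj, rfl⟩

theorem codeMap_Gab_le_succ (σ : K ≃ₐ[F] K) (k : ℕ) (α : Fin n → K) :
    codeMap (σ : K ≃+* K) (Gab σ k α) ≤ Gab σ (k + 1) α := by
  rw [codeMap_Gab, Submodule.span_le]
  rintro v ⟨j, hj, rfl⟩
  have h := mem_Gab σ (Nat.succ_lt_succ hj) α
  simpa [pow_succ', AlgEquiv.mul_apply] using h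

/-- Once two consecutive Gabidulin codes agree, the chain is stationary. -/
theorem Gab_le_of_succ_le {σ : K ≃ₐ[F] K} {k : ℕ} {α : Fin n → K}
    (h : Gab σ (k + 1) α ≤ Gab σ k α) (j : ℕ) : (fun x => (σ ^ j) (α x)) ∈ Gab σ k α := by
  induction j with
  | zero => exact h (mem_Gab σ k.succ_pos α)
  | succ j ih =>
    have hm := h (codeMap_Gab_le_succ σ k α (Submodule.mem_map_of_mem ih))
    rw [pow_succ']
    exact hm

/-- A vector orthogonal to all conjugates of an `F`-independent vector vanishes. -/
theorem eq_zero_of_sum_mul_conj_eq_zero [FiniteDimensional F K] [IsGalois F K]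
    {α : Fin n → K} (hα : LinearIndependent F α) (c : Fin n → K)
    (hc : ∀ ρ : K ≃ₐ[F] K, ∑ x, c x * ρ (α x) = 0) : c = 0 := by
  have key (y : K) (x : Fin n) : Algebra.trace F K (y * c x) = 0 := by
    refine Fintype.linearIndependent_iff.mp hα (fun x => Algebra.trace F K (y * c x)) ?_ x
    simp only [Algebra.smul_def, trace_eq_sum_automorphisms, Finset.sum_mul]
    rw [Finset.sum_comm]
    refine Finset.sum_eq_zero fun ρ _ => ?_
    have h := congrArg (fun z => ρ (y * z)) (hc ρ⁻¹)
    simp only [Finset.mul_sum, map_sum, map_mul, mul_zero, map_zero] at h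
    rw [← h]
    refine Finset.sum_congr rfl fun x _ => ?_
    have hx : ρ (ρ⁻¹ (α x)) = α x := by rw [← AlgEquiv.mul_apply]; simp
    rw [hx, map_mul, mul_assoc]
  funext x
  refine (traceForm_nondegenerate F K).1 (c x) fun y => ?_
  rw [Algebra.traceForm_apply, mul_comm]
  exact key y x

theorem eq_top_of_forall_conj_mem [FiniteDimensional F K] [IsGalois F K]
    {α : Fin n → K} (hα : LinearIndependent F α) (W : Submodule K (Fin n → K))
    (hW : ∀ ρ : K ≃ₐ[F] K, (fun x => ρ (α x)) ∈ W) : W = ⊤ := by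
  by_contra hne
  obtain ⟨f, hf, hfW⟩ := W.exists_le_ker_of_lt_top (lt_top_iff_ne_top.mpr hne)
  refine hf ?_
  have hc := eq_zero_of_sum_mul_conj_eq_zero hα (fun x => f (Pi.single x 1)) fun ρ => by
    have h : f (fun x => ρ (α x)) = 0 := hfW (hW ρ)
    rw [LinearMap.pi_apply_eq_sum_univ f] at h
    rw [← h]
    refine Finset.sum_congr rfl fun x _ => ?_
    rw [smul_eq_mul, mul_comm]
    congr 2
    funext y
    simp [Pi.single_apply, eq_comm]
  refine LinearMap.pi_ext' fun x => LinearMap.ext_ring ?_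
  simpa using congrFun hc x

theorem inv_pow_mul_pow_apply (σ : K ≃ₐ[F] K) {a k e : ℕ} (ha : a < k) (x : K) :
    (σ⁻¹ ^ e) ((σ ^ a) x) = (σ⁻¹ ^ (e + (k - 1 - a))) ((σ ^ (k - 1)) x) := by
  obtain ⟨b, rfl⟩ : ∃ b, k = a + b + 1 := ⟨k - 1 - a, by omega⟩
  have h : a + b + 1 - 1 - a = b := by omega
  rw [h, ← AlgEquiv.mul_apply, ← AlgEquiv.mul_apply, Nat.add_sub_cancel, pow_add, add_comm a b,
    pow_add, mul_assoc, inv_pow σ b, inv_mul_cancel_left]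

theorem Sseq_inv_pow_Gab (σ : K ≃ₐ[F] K) {d k : ℕ} (hd : 0 < d) (hdk : d ≤ k)
    (α : Fin n → K) (i : ℕ) :
    Sseq (σ⁻¹ ^ d) (Gab σ k α) i =
      Gab σ⁻¹ (k + i * d) (fun x => (σ ^ (k - 1)) (α x)) := by
  refine le_antisymm (Finset.sup_le fun j hj => ?_) ?_
  · rw [codeMap_Gab, Submodule.span_le]
    rintro v ⟨a, ha, rfl⟩
    have hji : d * j ≤ i * d := by
      rw [mul_comm]
      exact Nat.mul_le_mul_right d (Nat.lt_succ_iff.mp (Finset.mem_range.mp hj))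
    refine Submodule.subset_span ⟨d * j + (k - 1 - a), by omega, funext fun x => ?_⟩
    rw [← inv_pow_mul_pow_apply σ ha, pow_mul]
    rfl
  · rw [Gab, Submodule.span_le]
    rintro v ⟨t, ht, rfl⟩
    obtain ⟨j, hj, a, ha, rfl⟩ : ∃ j ≤ i, ∃ a < k, t = d * j + (k - 1 - a) := by
      by_cases h : i * d ≤ t
      · exact ⟨i, le_rfl, k - 1 - (t - i * d), by omega, by rw [mul_comm d]; omega⟩
      · have hr := Nat.mod_lt t hd
        refine ⟨t / d, ?_, k - 1 - t % d, by omega, ?_⟩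
        · exact (Nat.div_lt_of_lt_mul (by rw [mul_comm]; omega)).le
        · have := Nat.div_add_mod t d
          omega
    refine Finset.le_sup (f := fun j => codeMap (((σ⁻¹ ^ d) ^ j : K ≃ₐ[F] K) : K ≃+* K)
      (Gab σ k α)) (Finset.mem_range.mpr (Nat.lt_succ_of_le hj)) ?_
    simp only [codeMap_Gab]
    refine Submodule.subset_span ⟨a, ha, funext fun x => ?_⟩
    rw [← inv_pow_mul_pow_apply σ ha, pow_mul]
    rfl

end GabidulinLemmas

/-- for a Gabidulin code `C = G_k^σ(α)` and `m−k ≤ ℓ ≤ m−1`,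
`S_i^{σ^ℓ}(C) = G_{k+i(m−ℓ)}^{σ⁻¹}(σ^{k−1}(α))` and
`s_i^{σ^ℓ}(C) = min{k+i(m−ℓ), n}`. -/
theorem gabidulin_sseq_large_power
    {F K : Type} [Field F] [Field K] [Algebra F K] [Fintype F] [Fintype K]
    (m : ℕ) (hm : Module.finrank F K = m)
    (σ : K ≃ₐ[F] K) (hσ : ∀ τ : K ≃ₐ[F] K, τ ∈ Subgroup.zpowers σ)
    (n k : ℕ) (hk1 : 1 ≤ k) (hkn : k ≤ n) (hnm : n ≤ m)
    (α : Fin n → K) (hα : LinearIndependent F α)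
    (C : Submodule K (Fin n → K)) (hC : C = Gab σ k α)
    (ℓ : ℕ) (hℓ1 : m - k ≤ ℓ) (hℓ2 : ℓ ≤ m - 1) (i : ℕ) :
    Sseq (σ ^ ℓ) C i = Gab σ⁻¹ (k + i * (m - ℓ)) (fun x => (σ ^ (k - 1)) (α x)) ∧
    sseq (σ ^ ℓ) C i = min (k + i * (m - ℓ)) n := by
  subst hC
  have hm' : σ ^ m = 1 := by
    rw [← hm, ← IsGalois.card_aut_eq_finrank F K]
    exact pow_card_eq_one'
  have hℓm : ℓ < m := by omega
  have hpow : σ ^ ℓ = σ⁻¹ ^ (m - ℓ) := by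
    rw [inv_pow, eq_inv_iff_mul_eq_one, ← pow_add, Nat.add_sub_cancel' hℓm.le, hm']
  have hS : Sseq (σ ^ ℓ) (Gab σ k α) i =
      Gab σ⁻¹ (k + i * (m - ℓ)) (fun x => (σ ^ (k - 1)) (α x)) := by
    rw [hpow]
    exact Sseq_inv_pow_Gab σ (by omega) (by omega) α i
  refine ⟨hS, ?_⟩
  rw [sseq, hS]
  refine finrank_Gab (fun τ => ?_) ?_ _
  · rw [Subgroup.zpowers_inv]
    exact hσ τ
  · exact hα.map' (σ ^ (k - 1)).toLinearMap
      (LinearMap.ker_eq_bot.mpr (σ ^ (k - 1)).injective)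
end

section
/- Let m = n and let C = G_k^σ(α) be a Gabidulin code of length n = m and dimension k. Then for every 0 ≤ ℓ ≤ m−1, s_1^{σ^ℓ}(C) = min{r, n}, where r = k+ℓ if 0 ≤ ℓ ≤ k, r = k+m−ℓ if m−k ≤ ℓ ≤ m−1, and r = 2k if k+1 ≤ ℓ ≤ m−k−1. -/
open Module

open Finset in
/-- Consecutive powers of an element of a finite group: `b` of them make up
`min b (orderOf g)` distinct elements. -/
theorem card_image_pow_Ico {G : Type*} [Group G] [Finite G] [DecidableEq G]
    (g : G) (a b : ℕ) :
    ((Ico a (a + b)).image fun i => g ^ i).card = min b (orderOf g) := by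
  have inj : ∀ c ≤ orderOf g,
      ((Ico a (a + c)).image fun i => g ^ i).card = c := by
    intro c hc
    rw [card_image_of_injOn]
    · simp
    · intro i hi j hj hij
      simp only [coe_Ico, Set.mem_Ico] at hi hj
      have h : i ≡ j [MOD orderOf g] := pow_eq_pow_iff_modEq.mp hij
      obtain ⟨i, rfl⟩ := Nat.exists_eq_add_of_le hi.1
      obtain ⟨j, rfl⟩ := Nat.exists_eq_add_of_le hj.1
      rw [Nat.ModEq.add_left_cancel' a h |>.eq_of_lt_of_lt (by omega) (by omega)]
  rcases le_total b (orderOf g) with hb | hb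
  · rw [inj b hb, min_eq_left hb]
  · rw [min_eq_right hb]
    refine Eq.trans (congrArg card ?_) (inj _ le_rfl)
    apply Subset.antisymm
    · intro x hx
      obtain ⟨i, hi, rfl⟩ := mem_image.mp hx
      rw [mem_Ico] at hi
      have hpos := orderOf_pos g
      refine mem_image.mpr ⟨a + (i - a) % orderOf g, ?_, ?_⟩
      · have := Nat.mod_lt (i - a) hpos
        simp only [mem_Ico]
        omega
      · rw [pow_add, pow_mod_orderOf, ← pow_add, Nat.add_sub_cancel' hi.1]
    · exact image_subset_image (Ico_subset_Ico_right (by omega))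

section Conjugates

variable {F K : Type} [Field F] [Field K] [Algebra F K]

/-- The vectors of conjugates of an `F`-spanning family of `K`, one for each automorphism,
are `K`-linearly independent. -/
theorem linearIndependent_algEquiv_apply {n : ℕ} {α : Fin n → K}
    (hα : Submodule.span F (Set.range α) = ⊤) :
    LinearIndependent K fun (τ : K ≃ₐ[F] K) (x : Fin n) => τ (α x) := by
  have hinj : Function.Injective fun τ : K ≃ₐ[F] K => ((τ : K →* K)) := by
    intro τ ρ h
    ext x
    exact DFunLike.congr_fun h x
  have hd := (linearIndependent_monoidHom K K).comp _ hinj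
  rw [linearIndependent_iff'] at hd ⊢
  intro s c hc
  refine hd s c ?_
  have hlin : (∑ τ ∈ s, c τ • (τ : K ≃ₐ[F] K).toLinearMap : K →ₗ[F] K) = 0 := by
    refine LinearMap.ext_on_range hα fun x => ?_
    simpa using congrFun hc x
  funext y
  simpa using LinearMap.congr_fun hlin y

theorem codeMap_pow_Gab {n : ℕ} (σ : K ≃ₐ[F] K) (k l : ℕ) (α : Fin n → K) :
    codeMap ((σ ^ l : K ≃ₐ[F] K) : K ≃+* K) (Gab σ k α) =
      Submodule.span K ((fun (τ : K ≃ₐ[F] K) (x : Fin n) => τ (α x)) ''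
        ((fun i => σ ^ i) '' Set.Ico l (l + k))) := by
  rw [codeMap, Gab, Submodule.map_span]
  congr 1
  ext v
  constructor
  · rintro ⟨_, ⟨j, hj, rfl⟩, rfl⟩
    refine ⟨_, ⟨l + j, ⟨by omega, by omega⟩, rfl⟩, ?_⟩
    funext x
    exact DFunLike.congr_fun (pow_add σ l j) (α x)
  · rintro ⟨_, ⟨i, ⟨hi, hi'⟩, rfl⟩, rfl⟩
    obtain ⟨j, rfl⟩ := Nat.exists_eq_add_of_le hi
    refine ⟨_, ⟨j, by omega, rfl⟩, ?_⟩
    funext x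
    exact (DFunLike.congr_fun (pow_add σ l j) (α x)).symm

open Finset in
theorem sseq_pow_Gab_one [DecidableEq (K ≃ₐ[F] K)] {n : ℕ} {α : Fin n → K}
    (hα : Submodule.span F (Set.range α) = ⊤) (σ : K ≃ₐ[F] K) (k l : ℕ) :
    sseq (σ ^ l) (Gab σ k α) 1 =
      ((Ico 0 (0 + k) ∪ Ico l (l + k)).image fun i => σ ^ i).card := by
  have hS : Sseq (σ ^ l) (Gab σ k α) 1 =
      Submodule.span K (Set.range fun τ : ((Ico 0 (0 + k) ∪ Ico l (l + k)).image
        fun i => σ ^ i) => fun x => τ.1 (α x)) := by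
    have h0 := codeMap_pow_Gab σ k 0 α
    have h1 := codeMap_pow_Gab σ k l α
    rw [Sseq, range_add_one, sup_insert, range_one, sup_singleton, ← pow_mul, ← pow_mul,
      mul_one, mul_zero, h0, h1, ← Submodule.span_union, ← Set.image_union, ← Set.image_union]
    congr 1
    ext v
    simp only [Set.mem_image, Set.mem_range, Set.mem_union, Set.mem_Ico, Subtype.exists,
      mem_image, mem_union, mem_Ico, exists_prop, or_comm]
  rw [sseq, hS, ← Fintype.card_coe]
  exact finrank_span_eq_card
    ((linearIndependent_algEquiv_apply hα).comp _ Subtype.val_injective)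

end Conjugates

/-- for `m = n` and a Gabidulin code `C = G_k^σ(α)` of length `m`,
`s_1^{σ^ℓ}(C) = min{r, n}` with `r` given piecewise in `ℓ`. -/
theorem gabidulin_sseq_one_full_length
    {F K : Type} [Field F] [Field K] [Algebra F K] [Fintype F] [Fintype K]
    (m : ℕ) (hm : Module.finrank F K = m)
    (σ : K ≃ₐ[F] K) (hσ : ∀ τ : K ≃ₐ[F] K, τ ∈ Subgroup.zpowers σ)
    (k : ℕ) (hk1 : 1 ≤ k) (hkn : k ≤ m)
    (α : Fin m → K) (hα : LinearIndependent F α)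
    (C : Submodule K (Fin m → K)) (hC : C = Gab σ k α)
    (ℓ : ℕ) (hℓ : ℓ ≤ m - 1) :
    (ℓ ≤ k → sseq (σ ^ ℓ) C 1 = min (k + ℓ) m) ∧
    (m - k ≤ ℓ → sseq (σ ^ ℓ) C 1 = min (k + (m - ℓ)) m) ∧
    (k + 1 ≤ ℓ → ℓ ≤ m - k - 1 → sseq (σ ^ ℓ) C 1 = min (2 * k) m) := by
  classical
  subst hC
  have hspan : Submodule.span F (Set.range α) = ⊤ :=
    hα.span_eq_top_of_card_eq_finrank' (by simp [hm])
  have hord : orderOf σ = m := by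
    rw [orderOf_eq_card_of_forall_mem_zpowers hσ, IsGalois.card_aut_eq_finrank, hm]
  rw [sseq_pow_Gab_one hspan]
  refine ⟨fun h => ?_, fun h => ?_, fun h h' => ?_⟩
  · have hu : Finset.Ico 0 (0 + k) ∪ Finset.Ico ℓ (ℓ + k) = Finset.Ico 0 (0 + (k + ℓ)) := by
      ext i
      simp only [Finset.mem_union, Finset.mem_Ico]
      omega
    rw [hu, card_image_pow_Ico, hord]
  · have hshift : (Finset.Ico 0 (0 + k)).image (fun i => σ ^ i) =
        (Finset.Ico m (m + k)).image fun i => σ ^ i := by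
      rw [← zero_add m, add_right_comm, ← Finset.image_add_right_Ico, Finset.image_image]
      refine Finset.image_congr fun i _ => ?_
      simp [pow_add, ← hord, pow_orderOf_eq_one]
    have hu : Finset.Ico m (m + k) ∪ Finset.Ico ℓ (ℓ + k) =
        Finset.Ico ℓ (ℓ + (k + (m - ℓ))) := by
      ext i
      simp only [Finset.mem_union, Finset.mem_Ico]
      omega
    rw [Finset.image_union, hshift, ← Finset.image_union, hu, card_image_pow_Ico, hord]
  · rw [Finset.card_image_of_injOn, Finset.card_union_of_disjoint]
    · simp only [Nat.card_Ico]
      omega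
    · rw [Finset.disjoint_left]
      intro i
      simp only [Finset.mem_Ico]
      omega
    · intro i hi j hj hij
      simp only [Finset.coe_union, Finset.coe_Ico, Set.mem_union, Set.mem_Ico] at hi hj
      exact pow_injOn_Iio_orderOf (by simp only [Set.mem_Iio]; omega)
        (by simp only [Set.mem_Iio]; omega) hij
end

section
/- Let C = H_{k,η}^σ(α) be a Sheekey twisted Gabidulin code with 2 ≤ k ≤ n−1, η ≠ 0, and N(η) ≠ (−1)^{km}. Then for all integers m−k+1 ≤ ℓ ≤ m−1 and i ≥ 1, S_i^{σ^ℓ}(C) equals the F_{q^m}-span of {σ^k(α), σ^{k−1}(α), …, σ^{k−(k+i(m−ℓ))}(α)} (i.e., the code H_{k,η^{-1}}^{σ^{-1}}-type span G_{k+i(m−ℓ)+1}^{σ^{-1}}(σ^k(α)), powers of σ taken in the cyclic group Gal(F_{q^m}/F_q) so negative exponents are interpreted modulo m), and s_i^{σ^ℓ}(C) = min{k+i(m−ℓ)+1, n}. -/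
open Module

section LinearizedPolynomials

variable {F K : Type} [Field F] [Field K] [Algebra F K]

/-- A `σ`-polynomial of `σ`-degree less than `d` which vanishes at `d` elements linearly
independent over the fixed field of `σ` is zero. -/
theorem sigma_polynomial_coeff_eq_zero (σ : K ≃ₐ[F] K)
    (hfix : ∀ x, σ x = x → x ∈ Set.range (algebraMap F K)) (d : ℕ) (c : ℕ → K)
    (β : Fin d → K) (hβ : LinearIndependent F β)
    (h : ∀ x, ∑ j ∈ Finset.range d, c j * (σ ^ j) (β x) = 0) : ∀ j < d, c j = 0 := by
  induction d generalizing c with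
  | zero => intro j hj; omega
  | succ d ih =>
    have hb : β 0 ≠ 0 := hβ.ne_zero 0
    set b := β 0 with hbdef
    have hpow : ∀ j : ℕ, (σ ^ j) b ≠ 0 := fun j => (map_ne_zero (σ ^ j)).2 hb
    set c' : ℕ → K := fun j => c j * (σ ^ j) b with hc'
    set g : ℕ → K := fun j => ∑ t ∈ Finset.range j, c' t with hg
    have hsum : ∀ x, ∑ j ∈ Finset.range (d + 1), c' j * (σ ^ j) (β x / b) = 0 := by
      intro x
      rw [← h x]
      refine Finset.sum_congr rfl fun j _ => ?_
      have : (σ ^ j) b ≠ 0 := hpow j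
      simp only [hc', map_div₀]
      field_simp
    have hparts : ∀ (y : K) (e : ℕ), ∑ j ∈ Finset.range e, c' j * (σ ^ j) y =
        g e * (σ ^ e) y - ∑ j ∈ Finset.range e, g (j + 1) * (σ ^ j) (σ y - y) := by
      intro y e
      induction e with
      | zero => simp [hg]
      | succ e ihe =>
        have hge : g (e + 1) = g e + c' e := Finset.sum_range_succ _ _
        rw [Finset.sum_range_succ, ihe, Finset.sum_range_succ, hge, map_sub, pow_succ,
          AlgEquiv.mul_apply]
        ring
    have htot : g (d + 1) = 0 := by
      have h0 := hsum 0
      rw [← hbdef, div_self hb] at h0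
      simpa [hg] using h0
    have hγ : LinearIndependent F fun x : Fin d => σ (β x.succ / b) - β x.succ / b := by
      rw [Fintype.linearIndependent_iff]
      intro f hf
      obtain ⟨e, he⟩ := hfix (∑ x, f x • (β x.succ / b)) <| by
        rw [map_sum, ← sub_eq_zero, ← Finset.sum_sub_distrib, ← hf]
        exact Finset.sum_congr rfl fun x _ => by rw [map_smul, smul_sub]
      have hrel : ∑ x, (Fin.cons (-e) f : Fin (d + 1) → F) x • β x = 0 := by
        have hm : ∑ x, f x • β x.succ = e • b := by
          rw [Algebra.smul_def, he, Finset.sum_mul]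
          exact Finset.sum_congr rfl fun x _ => by
            rw [smul_mul_assoc, div_mul_cancel₀ _ hb]
        simp [Fin.sum_univ_succ, hm, ← hbdef]
      intro x
      simpa using Fintype.linearIndependent_iff.1 hβ _ hrel x.succ
    have hgz : ∀ j < d, g (j + 1) = 0 := by
      refine ih (fun j => g (j + 1)) _ hγ fun x => ?_
      have hx := hsum x.succ
      rw [hparts, htot, Finset.sum_range_succ, htot] at hx
      simpa using hx
    have hg0 : ∀ j ≤ d + 1, g j = 0 := by
      rintro (_ | j) hj
      · simp [hg]
      · rcases (show j ≤ d by omega).lt_or_eq with hlt | rfl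
        exacts [hgz j hlt, htot]
    intro j hj
    have hc0 : c' j = 0 := by
      have hgj : g (j + 1) = g j + c' j := Finset.sum_range_succ _ _
      rw [hg0 _ (by omega), hg0 _ (by omega), zero_add] at hgj
      exact hgj.symm
    exact (mul_eq_zero.1 hc0).resolve_right (hpow j)

theorem linearIndependent_pow_comp {n d : ℕ} (hd : d ≤ n) (σ : K ≃ₐ[F] K)
    (hfix : ∀ x, σ x = x → x ∈ Set.range (algebraMap F K))
    (β : Fin n → K) (hβ : LinearIndependent F β) :
    LinearIndependent K fun (j : Fin d) (x : Fin n) => (σ ^ (j : ℕ)) (β x) := by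
  rw [Fintype.linearIndependent_iff]
  intro c hc j
  have key := sigma_polynomial_coeff_eq_zero σ hfix d
    (fun j => if hj : j < d then c ⟨j, hj⟩ else 0) (β ∘ Fin.castLE hd)
    (hβ.comp _ (Fin.castLE_injective hd)) (fun x => by
      rw [Finset.sum_range]
      simpa [Finset.sum_apply] using congrFun hc (Fin.castLE hd x)) j j.2
  simpa using key

theorem Gab_eq_span_range {n : ℕ} (σ : K ≃ₐ[F] K) (d : ℕ) (β : Fin n → K) :
    Gab σ d β = Submodule.span K
      (Set.range fun (j : Fin d) (x : Fin n) => (σ ^ (j : ℕ)) (β x)) := by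
  unfold Gab
  congr 1
  ext v
  simp only [Set.mem_ofPred_eq, Set.mem_range, Fin.exists_iff, exists_prop, eq_comm]

theorem Gab_mono_s14 {n : ℕ} (σ : K ≃ₐ[F] K) {d e : ℕ} (h : d ≤ e) (β : Fin n → K) :
    Gab σ d β ≤ Gab σ e β :=
  Submodule.span_mono fun _ ⟨j, hj, hv⟩ => ⟨j, hj.trans_le h, hv⟩

theorem finrank_Gab_s14 {n : ℕ} (σ : K ≃ₐ[F] K)
    (hfix : ∀ x, σ x = x → x ∈ Set.range (algebraMap F K))
    (d : ℕ) (β : Fin n → K) (hβ : LinearIndependent F β) :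
    finrank K (Gab σ d β) = min d n := by
  have hle : ∀ d ≤ n, finrank K (Gab σ d β) = d := fun d hd => by
    rw [Gab_eq_span_range, finrank_span_eq_card (linearIndependent_pow_comp hd σ hfix β hβ),
      Fintype.card_fin]
  rcases le_total d n with hd | hd
  · rw [hle d hd, min_eq_left hd]
  · rw [min_eq_right hd]
    refine le_antisymm ?_ ?_
    · simpa using Submodule.finrank_le (Gab σ d β)
    · simpa [hle n le_rfl] using Submodule.finrank_mono (Gab_mono_s14 σ hd β)

end LinearizedPolynomials

section ShiftedCodes

variable {F K : Type} [Field F] [Field K] [Algebra F K] {n : ℕ}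

/-- The vector `σ^s(α)` for an integer exponent `s`. -/
def zpowVec (σ : K ≃ₐ[F] K) (α : Fin n → K) (s : ℤ) : Fin n → K := fun x => (σ ^ s) (α x)

theorem Gab_inv_eq_span_zpowVec (σ : K ≃ₐ[F] K) (α : Fin n → K) (k D : ℕ) :
    Gab σ⁻¹ (k + D + 1) (fun x => (σ ^ k) (α x)) =
      Submodule.span K (zpowVec σ α '' Set.Icc (-D : ℤ) k) := by
  have hpow : ∀ j : ℕ, (fun x => (σ⁻¹ ^ j) ((σ ^ k) (α x))) = zpowVec σ α (k - j) := by
    intro j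
    funext x
    rw [zpowVec, ← AlgEquiv.mul_apply, inv_pow, ← zpow_natCast, ← zpow_natCast, ← zpow_neg,
      ← zpow_add, neg_add_eq_sub]
  unfold Gab
  congr 1
  ext v
  simp only [Set.mem_ofPred_eq, Set.mem_image, Set.mem_Icc, hpow]
  constructor
  · rintro ⟨j, hj, rfl⟩
    exact ⟨k - j, by omega, rfl⟩
  · rintro ⟨s, hs, rfl⟩
    exact ⟨(k - s).toNat, by omega, by congr 1; omega⟩

theorem TGab_eq_span_zpowVec (σ : K ≃ₐ[F] K) (α : Fin n → K) (k : ℕ) (η : K) :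
    TGab σ k η α = Submodule.span K
      (insert (zpowVec σ α 0 + η • zpowVec σ α k) (zpowVec σ α '' Set.Ioo (0 : ℤ) k)) := by
  unfold TGab
  congr 1
  ext v
  simp only [Set.mem_insert_iff, Set.mem_ofPred_eq, Set.mem_image, Set.mem_Ioo]
  refine or_congr ?_ ⟨?_, ?_⟩
  · have : (fun x => α x + η * (σ ^ k) (α x)) = zpowVec σ α 0 + η • zpowVec σ α k := by
      funext x; simp [zpowVec]
    rw [this]
  · rintro ⟨j, h1, h2, rfl⟩
    exact ⟨j, by omega, by funext x; simp [zpowVec]⟩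
  · rintro ⟨s, hs, rfl⟩
    refine ⟨s.toNat, by omega, by omega, ?_⟩
    funext x
    rw [zpowVec, ← zpow_natCast, Int.toNat_of_nonneg hs.1.le]

theorem entrywiseMap_zpowVec (σ : K ≃ₐ[F] K) (α : Fin n → K) (t s : ℤ) :
    entrywiseMap n ((σ ^ t : K ≃ₐ[F] K) : K ≃+* K) (zpowVec σ α s) = zpowVec σ α (s + t) := by
  funext x
  change (σ ^ t) ((σ ^ s) (α x)) = _
  rw [zpowVec, add_comm, zpow_add, AlgEquiv.mul_apply]

theorem codeMap_zpow_TGab (σ : K ≃ₐ[F] K) (α : Fin n → K) (k : ℕ) (η : K) (t : ℤ) :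
    codeMap ((σ ^ t : K ≃ₐ[F] K) : K ≃+* K) (TGab σ k η α) = Submodule.span K
      (insert (zpowVec σ α t + (σ ^ t) η • zpowVec σ α (k + t))
        (zpowVec σ α '' Set.Ioo t (k + t))) := by
  rw [codeMap, TGab_eq_span_zpowVec, Submodule.map_span, Set.image_insert_eq, Set.image_image]
  congr 1
  congr 1
  · rw [map_add, map_smulₛₗ, entrywiseMap_zpowVec, entrywiseMap_zpowVec, zero_add]
    rfl
  · simp only [entrywiseMap_zpowVec]
    ext v
    simp only [Set.mem_image, Set.mem_Ioo]
    constructor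
    · rintro ⟨s, hs, rfl⟩
      exact ⟨s + t, by omega, rfl⟩
    · rintro ⟨s, hs, rfl⟩
      exact ⟨s - t, by omega, by rw [sub_add_cancel]⟩

/-- If `0 < r < k`, the sum of the codes `σ^{-rj}(H_{k,η}^σ(α))`, `0 ≤ j ≤ i`, is spanned by
the consecutive vectors `σ^s(α)`, `-ir ≤ s ≤ k`. -/
theorem Sseq_TGab_eq_span_zpowVec (σ τ : K ≃ₐ[F] K) (α : Fin n → K) (k r : ℕ) (hr : 0 < r)
    (hrk : r < k) (hτ : τ = σ ^ (-r : ℤ)) (η : K) (hη : η ≠ 0) (i : ℕ) (hi : 1 ≤ i) :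
    Sseq τ (TGab σ k η α) i =
      Submodule.span K (zpowVec σ α '' Set.Icc (-(i * r : ℕ) : ℤ) k) := by
  have hS : Sseq τ (TGab σ k η α) i = (Finset.range (i + 1)).sup fun j : ℕ => Submodule.span K
      (insert (zpowVec σ α (-(j * r : ℕ)) +
          (σ ^ (-(j * r : ℕ) : ℤ)) η • zpowVec σ α (k + -(j * r : ℕ)))
        (zpowVec σ α '' Set.Ioo (-(j * r : ℕ) : ℤ) (k + -(j * r : ℕ)))) := by
    refine Finset.sup_congr rfl fun j _ => ?_
    rw [← codeMap_zpow_TGab, hτ, ← zpow_natCast, ← zpow_mul]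
    congr 4
    push_cast
    ring
  rw [hS]
  apply le_antisymm
  · refine Finset.sup_le fun j hj => Submodule.span_le.2 ?_
    have hji : j * r ≤ i * r := Nat.mul_le_mul_right r (by simpa [Nat.lt_succ_iff] using hj)
    have hmem : ∀ s : ℤ, -(i * r : ℕ) ≤ s → s ≤ k →
        zpowVec σ α s ∈ Submodule.span K (zpowVec σ α '' Set.Icc (-(i * r : ℕ) : ℤ) k) :=
      fun s h1 h2 => Submodule.subset_span ⟨s, ⟨h1, h2⟩, rfl⟩
    rintro v (rfl | ⟨s, ⟨h1, h2⟩, rfl⟩)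
    · exact add_mem (hmem _ (by omega) (by omega))
        (Submodule.smul_mem _ _ (hmem _ (by omega) (by omega)))
    · exact hmem _ (by omega) (by omega)
  · set S := (Finset.range (i + 1)).sup fun j : ℕ => Submodule.span K
      (insert (zpowVec σ α (-(j * r : ℕ)) +
          (σ ^ (-(j * r : ℕ) : ℤ)) η • zpowVec σ α (k + -(j * r : ℕ)))
        (zpowVec σ α '' Set.Ioo (-(j * r : ℕ) : ℤ) (k + -(j * r : ℕ))))
    have hsub : ∀ j ≤ i, _ ≤ S := fun j hj => Finset.le_sup (Finset.mem_range_succ_iff.2 hj)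
    have hIoo : ∀ j ≤ i, ∀ s : ℤ, -(j * r : ℕ) < s → s < k + -(j * r : ℕ) →
        zpowVec σ α s ∈ S := fun j hj s h1 h2 =>
      hsub j hj (Submodule.subset_span (Or.inr ⟨s, ⟨h1, h2⟩, rfl⟩))
    have htwist : ∀ j ≤ i, zpowVec σ α (-(j * r : ℕ)) +
        (σ ^ (-(j * r : ℕ) : ℤ)) η • zpowVec σ α (k + -(j * r : ℕ)) ∈ S := fun j hj =>
      hsub j hj (Submodule.subset_span (Or.inl rfl))
    have hinner : ∀ j ≤ i, ∀ s : ℤ, -(j * r : ℕ) < s → s < k → zpowVec σ α s ∈ S := by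
      intro j
      induction j with
      | zero => exact fun hj s h1 h2 => hIoo 0 hj s h1 (by simpa using h2)
      | succ j ih =>
        intro hj s h1 h2
        by_cases hs : s < k + -((j + 1) * r : ℕ)
        · exact hIoo _ hj s h1 hs
        · rw [add_mul, one_mul] at hs
          exact ih (by omega) s (by omega) h2
    have hir : r ≤ i * r := Nat.le_mul_of_pos_left r hi
    refine Submodule.span_le.2 ?_
    rintro _ ⟨s, ⟨h1, h2⟩, rfl⟩
    rcases h2.lt_or_eq with h2 | rfl
    · rcases h1.lt_or_eq with h1 | rfl
      · exact hinner i le_rfl s h1 h2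
      · exact (Submodule.add_mem_iff_left _ (Submodule.smul_mem _ _
          (hinner i le_rfl _ (by omega) (by omega)))).1 (htwist i le_rfl)
    · have h0 := htwist 0 (Nat.zero_le i)
      simp only [zero_mul, Nat.cast_zero, neg_zero, add_zero, zpow_zero,
        AlgEquiv.one_apply] at h0
      exact (Submodule.smul_mem_iff _ hη).1
        ((Submodule.add_mem_iff_right _ (hinner i le_rfl 0 (by omega) (by omega))).1 h0)

end ShiftedCodes

/-- for a Sheekey twisted Gabidulin code `C = H_{k,η}^σ(α)` with
`N(η) ≠ (−1)^{km}` and `m−k+1 ≤ ℓ ≤ m−1`, `i ≥ 1`, one has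
`S_i^{σ^ℓ}(C) = G_{k+i(m−ℓ)+1}^{σ⁻¹}(σ^k(α))` and
`s_i^{σ^ℓ}(C) = min{k+i(m−ℓ)+1, n}`. -/
theorem sheekey_sseq_large_power
    {F K : Type} [Field F] [Field K] [Algebra F K] [Fintype F] [Fintype K]
    (m : ℕ) (hm : Module.finrank F K = m)
    (σ : K ≃ₐ[F] K) (hσ : ∀ τ : K ≃ₐ[F] K, τ ∈ Subgroup.zpowers σ)
    (n k : ℕ) (hk1 : 2 ≤ k) (hkn : k + 1 ≤ n) (hnm : n ≤ m)
    (α : Fin n → K) (hα : LinearIndependent F α)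
    (η : K) (hη : η ≠ 0) (hN : Algebra.norm F η ≠ (-1 : F) ^ (k * m))
    (C : Submodule K (Fin n → K)) (hC : C = TGab σ k η α)
    (ℓ : ℕ) (hℓ1 : m - k + 1 ≤ ℓ) (hℓ2 : ℓ ≤ m - 1) (i : ℕ) (hi : 1 ≤ i) :
    Sseq (σ ^ ℓ) C i = Gab σ⁻¹ (k + i * (m - ℓ) + 1) (fun x => (σ ^ k) (α x)) ∧
    sseq (σ ^ ℓ) C i = min (k + i * (m - ℓ) + 1) n := by
  have hfix : ∀ x, σ⁻¹ x = x → x ∈ Set.range (algebraMap F K) := by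
    intro x hx
    rw [← IntermediateField.mem_bot, IsGalois.mem_bot_iff_fixed]
    intro τ
    have hstab : σ ∈ MulAction.stabilizer (K ≃ₐ[F] K) x :=
      inv_mem_iff.1 (MulAction.mem_stabilizer_iff.2 hx)
    exact MulAction.mem_stabilizer_iff.1 (Subgroup.zpowers_le.2 hstab (hσ τ))
  have hord : σ ^ m = 1 := by
    rw [← hm, ← IsGalois.card_aut_eq_finrank]
    exact pow_card_eq_one'
  have hτ : σ ^ ℓ = σ ^ (-(m - ℓ : ℕ) : ℤ) := by
    rw [zpow_neg, zpow_natCast, eq_inv_iff_mul_eq_one, ← pow_add,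
      Nat.add_sub_cancel' (by omega), hord]
  have hS : Sseq (σ ^ ℓ) C i =
      Gab σ⁻¹ (k + i * (m - ℓ) + 1) (fun x => (σ ^ k) (α x)) := by
    rw [hC, Gab_inv_eq_span_zpowVec]
    exact Sseq_TGab_eq_span_zpowVec σ _ α k (m - ℓ) (by omega) (by omega) hτ η hη i hi
  refine ⟨hS, ?_⟩
  rw [sseq, hS]
  exact finrank_Gab_s14 _ hfix _ _ (hα.map' (σ ^ k).toLinearMap (LinearMap.ker_eq_bot.2
    (σ ^ k).injective))
end

section
/- Let m = n and let C = H_{k,η}^σ(α) be a Sheekey twisted Gabidulin code of length n = m with η ≠ 0 and N(η) ≠ (−1)^{km}. Then for every 1 ≤ ℓ ≤ m−1, s_1^{σ^ℓ}(C) = min{r, m}, where r = k+ℓ+1 if 1 ≤ ℓ ≤ k−1, r = k+m−ℓ+1 if m−k+1 ≤ ℓ ≤ m−1, and r = 2k if k ≤ ℓ ≤ m−k. -/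
open Module

section TwistedGabidulin

variable {F K : Type} [Field F] [Field K] [Algebra F K]

/-- The vector `σ^i(α)`. -/
def frobVec {n : ℕ} (σ : K ≃ₐ[F] K) (α : Fin n → K) (i : ℕ) : Fin n → K :=
  fun x => (σ ^ i) (α x)

/-- The span of `v_a + η v_{a+k}, v_{a+1}, …, v_{a+k-1}`. -/
def twistedSpan {V : Type} [AddCommGroup V] [Module K V] (v : ℕ → V) (k a : ℕ) (η : K) :
    Submodule K V :=
  Submodule.span K (insert (v a + η • v (a + k)) (v '' Set.Ioo a (a + k)))

theorem TGab_eq_twistedSpan {n : ℕ} (σ : K ≃ₐ[F] K) (k : ℕ) (η : K) (α : Fin n → K) :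
    TGab σ k η α = twistedSpan (frobVec σ α) k 0 η := by
  unfold TGab twistedSpan
  congr 2
  · funext x
    simp [frobVec]
  · ext w
    constructor
    · rintro ⟨j, h1, h2, rfl⟩
      exact ⟨j, ⟨h1, by omega⟩, rfl⟩
    · rintro ⟨j, ⟨h1, h2⟩, rfl⟩
      exact ⟨j, h1, by omega, rfl⟩

theorem entrywiseMap_frobVec {n : ℕ} (σ : K ≃ₐ[F] K) (α : Fin n → K) (l i : ℕ) :
    entrywiseMap n ((σ ^ l : K ≃ₐ[F] K) : K ≃+* K) (frobVec σ α i) = frobVec σ α (l + i) := by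
  funext x
  change (σ ^ l) ((σ ^ i) (α x)) = (σ ^ (l + i)) (α x)
  rw [pow_add]
  rfl

theorem codeMap_twistedSpan {n : ℕ} (σ : K ≃ₐ[F] K) (k l : ℕ) (η : K) (α : Fin n → K) :
    codeMap ((σ ^ l : K ≃ₐ[F] K) : K ≃+* K) (twistedSpan (frobVec σ α) k 0 η) =
      twistedSpan (frobVec σ α) k l ((σ ^ l) η) := by
  unfold codeMap twistedSpan
  rw [Submodule.map_span, Set.image_insert_eq, map_add, map_smulₛₗ]
  simp only [entrywiseMap_frobVec, ← Set.image_comp]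
  congr 2
  · simp
  · ext w
    constructor
    · rintro ⟨j, ⟨h1, h2⟩, rfl⟩
      exact ⟨l + j, ⟨by omega, by omega⟩, (entrywiseMap_frobVec σ α l j).symm⟩
    · rintro ⟨j, ⟨h1, h2⟩, rfl⟩
      refine ⟨j - l, ⟨by omega, by omega⟩, ?_⟩
      rw [Function.comp_apply, entrywiseMap_frobVec]
      congr 1
      omega

theorem Sseq_one {n : ℕ} (σ : K ≃ₐ[F] K) (C : Submodule K (Fin n → K)) :
    Sseq σ C 1 = C ⊔ codeMap ((σ : K ≃ₐ[F] K) : K ≃+* K) C := by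
  have h : codeMap ((σ ^ 0 : K ≃ₐ[F] K) : K ≃+* K) C = C := by
    ext w
    constructor
    · rintro ⟨u, hu, rfl⟩
      exact hu
    · intro hw
      exact ⟨w, hw, rfl⟩
  simp only [Sseq, Finset.range_add_one, Finset.range_zero, Finset.sup_insert, Finset.sup_empty,
    h, pow_one, sup_bot_eq, sup_comm]

/-- Two overlapping twisted spans fill the whole interval of indices. -/
theorem twistedSpan_sup_of_overlap {V : Type} [AddCommGroup V] [Module K V] (v : ℕ → V)
    {k a d : ℕ} (hd1 : 1 ≤ d) (hdk : d + 1 ≤ k) (η : K) {θ : K} (hθ : θ ≠ 0) :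
    twistedSpan v k a η ⊔ twistedSpan v k (a + d) θ =
      Submodule.span K (v '' Set.Ico a (a + (k + d + 1))) := by
  apply le_antisymm
  · have hv : ∀ i, a ≤ i → i < a + (k + d + 1) →
        v i ∈ Submodule.span K (v '' Set.Ico a (a + (k + d + 1))) :=
      fun i h1 h2 => Submodule.subset_span ⟨i, ⟨h1, h2⟩, rfl⟩
    refine sup_le (Submodule.span_le.2 ?_) (Submodule.span_le.2 ?_)
    all_goals
      rintro w (rfl | ⟨i, ⟨h1, h2⟩, rfl⟩)
      · exact add_mem (hv _ (by omega) (by omega))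
          (Submodule.smul_mem _ _ (hv _ (by omega) (by omega)))
      · exact hv _ (by omega) (by omega)
  · set S := twistedSpan v k a η ⊔ twistedSpan v k (a + d) θ
    have hl : ∀ i, a < i → i < a + k → v i ∈ S := fun i h1 h2 =>
      Submodule.mem_sup_left (Submodule.subset_span (Or.inr ⟨i, ⟨h1, h2⟩, rfl⟩))
    have hr : ∀ i, a + d < i → i < a + d + k → v i ∈ S := fun i h1 h2 =>
      Submodule.mem_sup_right (Submodule.subset_span (Or.inr ⟨i, ⟨h1, h2⟩, rfl⟩))
    have hp : v a + η • v (a + k) ∈ S :=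
      Submodule.mem_sup_left (Submodule.subset_span (Or.inl rfl))
    have hq : v (a + d) + θ • v (a + d + k) ∈ S :=
      Submodule.mem_sup_right (Submodule.subset_span (Or.inl rfl))
    have hfirst : v a ∈ S :=
      (S.add_mem_iff_left (S.smul_mem η (hr (a + k) (by omega) (by omega)))).1 hp
    have hlast : v (a + d + k) ∈ S :=
      (S.smul_mem_iff hθ).1
        ((S.add_mem_iff_right (hl (a + d) (by omega) (by omega))).1 hq)
    rw [Submodule.span_le]
    rintro w ⟨i, ⟨h1, h2⟩, rfl⟩
    rcases eq_or_lt_of_le h1 with rfl | h1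
    · exact hfirst
    rcases lt_or_ge i (a + k) with h3 | h3
    · exact hl i h1 h3
    rcases lt_or_ge i (a + d + k) with h4 | h4
    · exact hr i (by omega) h4
    · rwa [show i = a + d + k by omega]

theorem finrank_span_image_Ico {V : Type} [AddCommGroup V] [Module K V] [FiniteDimensional K V]
    (v : ℕ → V) {a m : ℕ} (n : ℕ) (hV : Module.finrank K V = m)
    (hv : LinearIndependent K fun i : Fin m => v (a + i)) :
    Module.finrank K (Submodule.span K (v '' Set.Ico a (a + n))) = min n m := by
  rcases le_total n m with h | h
  · have hn : LinearIndependent K fun i : Fin n => v (a + i) :=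
      hv.comp (Fin.castLE h) (Fin.castLE_injective h)
    have hr : v '' Set.Ico a (a + n) = Set.range fun i : Fin n => v (a + i) := by
      ext w
      constructor
      · rintro ⟨i, ⟨h1, h2⟩, rfl⟩
        exact ⟨⟨i - a, by omega⟩, by simp [Nat.add_sub_cancel' h1]⟩
      · rintro ⟨i, rfl⟩
        exact ⟨a + i, ⟨by omega, by omega⟩, rfl⟩
    rw [hr, finrank_span_eq_card hn, Fintype.card_fin, min_eq_left h]
  · have ht : Submodule.span K (Set.range fun i : Fin m => v (a + i)) = ⊤ :=
      hv.span_eq_top_of_card_eq_finrank' (by simp [hV])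
    have hs : Submodule.span K (v '' Set.Ico a (a + n)) = ⊤ := by
      rw [eq_top_iff, ← ht]
      apply Submodule.span_mono
      rintro w ⟨i, rfl⟩
      exact ⟨a + i, ⟨by omega, by omega⟩, rfl⟩
    rw [hs, finrank_top, hV, min_eq_right h]

theorem finrank_span_sup_span_pair {V : Type} [AddCommGroup V] [Module K V]
    [FiniteDimensional K V] (s : Set V) (p q : V) (f g : V →ₗ[K] K)
    (hf : ∀ w ∈ s, f w = 0) (hg : ∀ w ∈ s, g w = 0) (hdet : f p * g q - f q * g p ≠ 0) :
    Module.finrank K ↥(Submodule.span K s ⊔ Submodule.span K {p, q}) =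
      Module.finrank K (Submodule.span K s) + 2 := by
  have key : ∀ x y : K, f (x • p + y • q) = 0 → g (x • p + y • q) = 0 → x = 0 ∧ y = 0 := by
    intro x y h1 h2
    simp only [map_add, map_smul, smul_eq_mul] at h1 h2
    constructor
    · refine (mul_eq_zero.1 (?_ : x * (f p * g q - f q * g p) = 0)).resolve_right hdet
      linear_combination g q * h1 - f q * h2
    · refine (mul_eq_zero.1 (?_ : y * (f p * g q - f q * g p) = 0)).resolve_right hdet
      linear_combination f p * h2 - g p * h1
  have hpair : Module.finrank K (Submodule.span K {p, q}) = 2 := by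
    have hli : LinearIndependent K ![p, q] :=
      LinearIndependent.pair_iff.2 fun x y h => key x y (by simp [h]) (by simp [h])
    have := finrank_span_eq_card hli
    rwa [Matrix.range_cons_cons_empty, Fintype.card_fin] at this
  have hker : ∀ e : V →ₗ[K] K, (∀ w ∈ s, e w = 0) → ∀ w ∈ Submodule.span K s, e w = 0 :=
    fun e he w hw => (Submodule.span_le.2 he : Submodule.span K s ≤ LinearMap.ker e) hw
  have hdisj : Submodule.span K s ⊓ Submodule.span K {p, q} = ⊥ := by
    rw [eq_bot_iff]
    rintro w ⟨hw1, hw2⟩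
    obtain ⟨x, y, rfl⟩ := Submodule.mem_span_pair.1 hw2
    obtain ⟨rfl, rfl⟩ := key x y (hker f hf _ hw1) (hker g hg _ hw1)
    simp
  have h := Submodule.finrank_sup_add_finrank_inf_eq (Submodule.span K s) (Submodule.span K {p, q})
  rwa [hdisj, finrank_bot, add_zero, hpair] at h

/-- Twisted spans with disjoint interiors, where the two twisted generators are independent. -/
theorem finrank_twistedSpan_sup_of_disjoint {V : Type} [AddCommGroup V] [Module K V]
    {m : ℕ} (v : ℕ → V) (b : Module.Basis (Fin m) K V) (hb : ∀ i : Fin m, b i = v i)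
    (hvm : v m = v 0) {k l : ℕ} (hk : 1 ≤ k) (hkl : k ≤ l) (hlm : l + k ≤ m) (η θ : K)
    (hne : k = l → l + k = m → η * θ ≠ 1) :
    Module.finrank K ↥(twistedSpan v k 0 η ⊔ twistedSpan v k l θ) = 2 * k := by
  classical
  have := b.finiteDimensional_of_finite
  have hcoord : ∀ i : Fin m, ∀ j, j < m → b.coord i (v j) = if (i : ℕ) = j then 1 else 0 := by
    intro i j hj
    rw [← hb ⟨j, hj⟩, b.coord_apply, b.repr_self, Finsupp.single_apply]
    simp only [Fin.ext_iff, eq_comm]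
  let T : Finset (Fin m) :=
    Finset.univ.filter fun i => ((i : ℕ) ∈ Finset.Ioo 0 k ∪ Finset.Ioo l (l + k))
  have hTcard : T.card = 2 * k - 2 := by
    have h : T.map Fin.valEmbedding = Finset.Ioo 0 k ∪ Finset.Ioo l (l + k) := by
      ext i
      simp only [T, Finset.mem_map, Finset.mem_filter, Finset.mem_univ, true_and,
        Fin.valEmbedding_apply]
      constructor
      · rintro ⟨j, hj, rfl⟩
        exact hj
      · intro hi
        have : i < m := by
          simp only [Finset.mem_union, Finset.mem_Ioo] at hi
          omega
        exact ⟨⟨i, this⟩, hi, rfl⟩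
    rw [← Finset.card_map Fin.valEmbedding, h, Finset.card_union_of_disjoint]
    · simp only [Nat.card_Ioo]
      omega
    · rw [Finset.disjoint_left]
      intro i hi hi'
      simp only [Finset.mem_Ioo] at hi hi'
      omega
  have hTv : v '' (Set.Ioo 0 k ∪ Set.Ioo l (l + k)) = Set.range fun i : T => b i := by
    ext w
    constructor
    · rintro ⟨i, hi, rfl⟩
      simp only [Set.mem_union, Set.mem_Ioo] at hi
      refine ⟨⟨⟨i, by omega⟩, ?_⟩, by simp [hb]⟩
      simpa [T] using hi
    · rintro ⟨⟨i, hi⟩, rfl⟩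
      refine ⟨i, ?_, by simp [hb]⟩
      simpa [T] using hi
  have hTrank : Module.finrank K (Submodule.span K (v '' (Set.Ioo 0 k ∪ Set.Ioo l (l + k)))) =
      2 * k - 2 := by
    have hli : LinearIndependent K fun i : T => b i :=
      b.linearIndependent.comp _ Subtype.val_injective
    rw [hTv, finrank_span_eq_card hli, Fintype.card_coe, hTcard]
  have hS : twistedSpan v k 0 η ⊔ twistedSpan v k l θ =
      Submodule.span K (v '' (Set.Ioo 0 k ∪ Set.Ioo l (l + k))) ⊔
        Submodule.span K {v 0 + η • v k, v l + θ • v (l + k)} := by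
    unfold twistedSpan
    rw [← Submodule.span_union, ← Submodule.span_union]
    congr 1
    ext w
    simp only [Set.image_union, Set.mem_union, Set.mem_insert_iff, Set.mem_singleton_iff, zero_add]
    tauto
  have hzero : ∀ i : Fin m, (i : ℕ) = 0 ∨ (i : ℕ) = l →
      ∀ w ∈ v '' (Set.Ioo 0 k ∪ Set.Ioo l (l + k)), b.coord i w = 0 := by
    rintro i hi w ⟨j, hj, rfl⟩
    simp only [Set.mem_union, Set.mem_Ioo] at hj
    rw [hcoord i j (by omega), if_neg (by omega)]
  rw [hS, finrank_span_sup_span_pair _ _ _ (b.coord ⟨0, by omega⟩) (b.coord ⟨l, by omega⟩)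
    (hzero _ (Or.inl rfl)) (hzero _ (Or.inr rfl)), hTrank]
  · omega
  · simp only [map_add, map_smul, smul_eq_mul]
    rw [hcoord _ 0 (by omega), hcoord _ k (by omega), hcoord _ l (by omega),
      hcoord _ 0 (by omega), hcoord _ k (by omega), hcoord _ l (by omega)]
    simp only [if_true, if_neg (show ¬ 0 = k by omega), if_neg (show ¬ 0 = l by omega),
      if_neg (show ¬ l = 0 by omega)]
    rcases hlm.lt_or_eq with h | h
    · rw [hcoord _ (l + k) h, hcoord _ (l + k) h, if_neg (by simp; omega), if_neg (by simp; omega)]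
      simp
    · rw [h, hvm, hcoord _ 0 (by omega), hcoord _ 0 (by omega)]
      simp only [if_true, if_neg (show ¬ l = 0 by omega)]
      rcases eq_or_ne l k with h' | h'
      · have := hne h'.symm h
        rw [if_pos h']
        intro h0
        apply this
        linear_combination -h0
      · rw [if_neg h']
        simp

variable [Finite K]

theorem orderOf_eq_finrank_of_forall_mem_zpowers (σ : K ≃ₐ[F] K)
    (hσ : ∀ τ : K ≃ₐ[F] K, τ ∈ Subgroup.zpowers σ) :
    orderOf σ = Module.finrank F K := by
  rw [orderOf_eq_card_of_forall_mem_zpowers hσ, IsGalois.card_aut_eq_finrank]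

theorem linearIndependent_frobVec {m : ℕ} (hm : Module.finrank F K = m) (σ : K ≃ₐ[F] K)
    (hσ : orderOf σ = m) (α : Fin m → K) (hα : LinearIndependent F α) (a : ℕ) :
    LinearIndependent K fun i : Fin m => frobVec σ α (a + i) := by
  have hspan : Submodule.span F (Set.range α) = ⊤ :=
    hα.span_eq_top_of_card_eq_finrank' (by simp [hm])
  rw [Fintype.linearIndependent_iff]
  intro c hc
  have hinj : Function.Injective fun i : Fin m => ((σ ^ (a + i) : K ≃ₐ[F] K) : K →* K) := by
    intro i j hij
    have h : σ ^ (a + i : ℕ) = σ ^ (a + j : ℕ) := AlgEquiv.ext fun x => DFunLike.congr_fun hij x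
    rw [pow_add, pow_add] at h
    exact Fin.ext (pow_injOn_Iio_orderOf (by simp [hσ]) (by simp [hσ]) (mul_left_cancel h))
  have hli := (linearIndependent_monoidHom K K).comp _ hinj
  rw [Fintype.linearIndependent_iff] at hli
  apply hli c
  let L : K →ₗ[F] K := ∑ i : Fin m, c i • (σ ^ (a + i : ℕ) : K ≃ₐ[F] K).toLinearMap
  have hL : L = 0 := by
    apply LinearMap.ext_on_range hspan
    intro x
    have := congrFun hc x
    simpa [L, frobVec] using this
  funext x
  have := LinearMap.congr_fun hL x
  simpa [L] using this

theorem norm_eq_one_of_mul_pow_half (σ : K ≃ₐ[F] K)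
    (hσ : ∀ τ : K ≃ₐ[F] K, τ ∈ Subgroup.zpowers σ) {k : ℕ} (hk : orderOf σ = 2 * k) {η : K}
    (h : η * (σ ^ k) η = 1) : Algebra.norm F η = 1 := by
  classical
  apply (algebraMap F K).injective
  rw [Algebra.norm_eq_prod_automorphisms, map_one, ← IsCyclic.image_range_orderOf hσ,
    Finset.prod_image (fun i hi j hj hij => pow_injOn_Iio_orderOf
      (by simpa using hi) (by simpa using hj) hij), hk, two_mul, Finset.prod_range_add,
    ← Finset.prod_mul_distrib]
  refine Finset.prod_eq_one fun i _ => ?_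
  simp only [add_comm k i, pow_add]
  rw [AlgEquiv.mul_apply, ← map_mul, h, map_one]

end TwistedGabidulin

/-- for `m = n` and a Sheekey twisted Gabidulin code
`C = H_{k,η}^σ(α)` of length `m` with `N(η) ≠ (−1)^{km}`, for every
`1 ≤ ℓ ≤ m−1` one has `s_1^{σ^ℓ}(C) = min{r, m}` with `r` given piecewise. -/
theorem sheekey_sseq_one_full_length
    {F K : Type} [Field F] [Field K] [Algebra F K] [Fintype F] [Fintype K]
    (m : ℕ) (hm : Module.finrank F K = m)
    (σ : K ≃ₐ[F] K) (hσ : ∀ τ : K ≃ₐ[F] K, τ ∈ Subgroup.zpowers σ)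
    (k : ℕ) (hk1 : 1 ≤ k) (hkn : k + 1 ≤ m)
    (α : Fin m → K) (hα : LinearIndependent F α)
    (η : K) (hη : η ≠ 0) (hN : Algebra.norm F η ≠ (-1 : F) ^ (k * m))
    (C : Submodule K (Fin m → K)) (hC : C = TGab σ k η α)
    (ℓ : ℕ) (hℓ1 : 1 ≤ ℓ) (hℓ2 : ℓ ≤ m - 1) :
    (ℓ ≤ k - 1 → sseq (σ ^ ℓ) C 1 = min (k + ℓ + 1) m) ∧
    (m - k + 1 ≤ ℓ → sseq (σ ^ ℓ) C 1 = min (k + (m - ℓ) + 1) m) ∧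
    (k ≤ ℓ → ℓ ≤ m - k → sseq (σ ^ ℓ) C 1 = min (2 * k) m) := by
  have hord : orderOf σ = m := (orderOf_eq_finrank_of_forall_mem_zpowers σ hσ).trans hm
  have hσm : σ ^ m = 1 := hord ▸ pow_orderOf_eq_one σ
  have hper : ∀ i, frobVec σ α (m + i) = frobVec σ α i := fun i => by
    unfold frobVec
    rw [pow_add, hσm, one_mul]
  have hli := linearIndependent_frobVec hm σ hord α hα
  have hV : Module.finrank K (Fin m → K) = m := by simp
  have hS : Sseq (σ ^ ℓ) C 1 = twistedSpan (frobVec σ α) k 0 η ⊔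
      twistedSpan (frobVec σ α) k ℓ ((σ ^ ℓ) η) := by
    rw [Sseq_one, hC, TGab_eq_twistedSpan, codeMap_twistedSpan]
  have hη' : (σ ^ ℓ) η ≠ 0 := by
    simpa only [ne_eq, EmbeddingLike.map_eq_zero_iff] using hη
  unfold sseq
  rw [hS]
  refine ⟨fun h => ?_, fun h => ?_, fun h1 h2 => ?_⟩
  · have := twistedSpan_sup_of_overlap (frobVec σ α) (a := 0) hℓ1 (by omega : ℓ + 1 ≤ k) η hη'
    rw [zero_add] at this
    rw [this, finrank_span_image_Ico _ _ hV (hli 0)]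
  · have hwrap : twistedSpan (frobVec σ α) k 0 η = twistedSpan (frobVec σ α) k (ℓ + (m - ℓ)) η := by
      have hm' : ℓ + (m - ℓ) = m := by omega
      have := codeMap_twistedSpan σ k m η α
      rw [hσm] at this
      rw [hm']
      refine Eq.trans ?_ this
      exact (Submodule.map_id _).symm
    rw [hwrap, sup_comm, twistedSpan_sup_of_overlap (frobVec σ α) (by omega) (by omega) _ hη,
      finrank_span_image_Ico _ _ hV (hli ℓ)]
  · have : NeZero m := ⟨by omega⟩
    have hb := coe_basisOfLinearIndependentOfCardEqFinrank
      (hli 0) (by simp : Fintype.card (Fin m) = Module.finrank K (Fin m → K))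
    rw [finrank_twistedSpan_sup_of_disjoint (frobVec σ α) _ (fun i => by
      rw [congrFun hb i, zero_add]) (hper 0) hk1 h1 (by omega), min_eq_left (by omega)]
    intro hkl hlm h1'
    subst hkl
    apply hN
    rw [norm_eq_one_of_mul_pow_half σ hσ (by omega) h1', show m = 2 * k by omega]
    exact ((even_two_mul k).mul_left k).neg_one_pow.symm
end

section
/- Suppose n divides m, let σ be a generator of Gal(F_{q^m}/F_q), and let α ∈ F_{q^m}^n be a vector whose entries form an F_q-basis of the subfield F_{q^n} ⊆ F_{q^m}. Let 1 ≤ k < n, let h ∈ {1, …, k−2} and t ∈ {2, …, n−k−1} (so h ∉ {0, k−1} and t ∉ {1, n−k}), let η ∈ F_{q^m} with η ≠ 0, and let C be the twisted Gabidulin code with one twist, i.e., the F_{q^m}-span of {σ^j(α) : 0 ≤ j ≤ k−1, j ≠ h} ∪ {σ^h(α) + η·σ^{k−1+t}(α)}. Set M = min{t−1, n−k−t}. Then s_i^σ(C) = k+1+2i for all 1 ≤ i ≤ M, and s_i^σ(C) = min{k+1+M+i, n} for all i > M. -/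
open Module

section AutomorphismOrbit

variable {F K : Type} [Field F] [Field K] [Algebra F K]

/-- The entrywise orbit `j ↦ σ^j(α)`. -/
def autOrbit {n : ℕ} (σ : K ≃ₐ[F] K) (α : Fin n → K) (j : ℕ) : Fin n → K :=
  fun x => (σ ^ j) (α x)

theorem entrywiseMap_autOrbit {n : ℕ} (σ : K ≃ₐ[F] K) (α : Fin n → K) (i j : ℕ) :
    entrywiseMap n ((σ ^ i : K ≃ₐ[F] K) : K ≃+* K) (autOrbit σ α j) =
      autOrbit σ α (i + j) := by
  funext x
  change (σ ^ i) ((σ ^ j) (α x)) = (σ ^ (i + j)) (α x)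
  rw [pow_add, AlgEquiv.mul_apply]

theorem entrywiseMap_mem_Sseq {n : ℕ} (σ : K ≃ₐ[F] K) {C : Submodule K (Fin n → K)}
    {i j : ℕ} (hj : j ≤ i) {v : Fin n → K} (hv : v ∈ C) :
    entrywiseMap n ((σ ^ j : K ≃ₐ[F] K) : K ≃+* K) v ∈ Sseq σ C i := by
  have hle : codeMap ((σ ^ j : K ≃ₐ[F] K) : K ≃+* K) C ≤ Sseq σ C i :=
    Finset.le_sup (f := fun j => codeMap ((σ ^ j : K ≃ₐ[F] K) : K ≃+* K) C)
      (Finset.mem_range.2 (Nat.lt_succ_of_le hj))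
  exact hle (Submodule.mem_map_of_mem hv)

variable [Fintype K]

theorem pow_mem_fixingSubgroup_iff (σ : K ≃ₐ[F] K)
    (hσ : ∀ τ : K ≃ₐ[F] K, τ ∈ Subgroup.zpowers σ) (E : IntermediateField F K) (d : ℕ) :
    σ ^ d ∈ E.fixingSubgroup ↔ Module.finrank F E ∣ d := by
  have hcard : Nat.card E.fixingSubgroup = Module.finrank E K :=
    IsGalois.card_fixingSubgroup_eq_finrank E
  have hmul : Module.finrank F E * Module.finrank E K = Module.finrank F K :=
    Module.finrank_mul_finrank F E K
  have hpos : 0 < Module.finrank E K := Module.finrank_pos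
  have hG : Nat.card (K ≃ₐ[F] K) = Module.finrank F K := IsGalois.card_aut_eq_finrank F K
  constructor
  · intro hd
    have h1 : (σ ^ d) ^ Module.finrank E K = 1 := by
      rw [← hcard]
      exact congrArg Subtype.val (pow_card_eq_one' (x := (⟨σ ^ d, hd⟩ : E.fixingSubgroup)))
    rw [← pow_mul] at h1
    have h2 := orderOf_dvd_of_pow_eq_one h1
    rw [orderOf_eq_card_of_forall_mem_zpowers hσ, hG, ← hmul] at h2
    exact Nat.dvd_of_mul_dvd_mul_right hpos h2
  · rintro ⟨c, rfl⟩
    have hnormal : E.fixingSubgroup.Normal := by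
      refine ⟨fun a ha g => ?_⟩
      obtain ⟨x, rfl⟩ := hσ a
      obtain ⟨y, rfl⟩ := hσ g
      simpa [← zpow_add, ← zpow_neg] using ha
    have hindex : E.fixingSubgroup.index = Module.finrank F E := by
      have h1 := E.fixingSubgroup.index_mul_card
      rw [hcard, hG, ← hmul] at h1
      exact Nat.eq_of_mul_eq_mul_right hpos h1
    rw [pow_mul, ← hindex]
    exact pow_mem (E.fixingSubgroup.pow_index_mem σ) c

theorem autOrbit_mod {n : ℕ} (σ : K ≃ₐ[F] K)
    (hσ : ∀ τ : K ≃ₐ[F] K, τ ∈ Subgroup.zpowers σ) (E : IntermediateField F K)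
    (hE : Module.finrank F E = n) {α : Fin n → K} (hα : ∀ x, α x ∈ E) (j : ℕ) :
    autOrbit σ α (j % n) = autOrbit σ α j := by
  funext x
  have hfix := (pow_mem_fixingSubgroup_iff σ hσ E (n * (j / n))).2 (hE ▸ dvd_mul_right _ _)
  have h1 := (IntermediateField.mem_fixingSubgroup_iff E _).1 hfix (α x) (hα x)
  change (σ ^ (j % n)) (α x) = (σ ^ j) (α x)
  conv_rhs => rw [← Nat.mod_add_div j n, pow_add, AlgEquiv.mul_apply, h1]

/-- The rows of the Moore matrix of a basis of `E` are linearly independent. -/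
theorem linearIndependent_autOrbit {n : ℕ} (σ : K ≃ₐ[F] K)
    (hσ : ∀ τ : K ≃ₐ[F] K, τ ∈ Subgroup.zpowers σ) (E : IntermediateField F K)
    (hE : Module.finrank F E = n) {α : Fin n → K}
    (hspan : Submodule.span F (Set.range α) = Subalgebra.toSubmodule E.toSubalgebra) :
    LinearIndependent K (fun j : Fin n => autOrbit σ α j) := by
  let φ : Fin n → (E →* K) := fun j =>
    (((σ ^ (j : ℕ) : K ≃ₐ[F] K) : K →* K).comp (algebraMap E K : E →* K))
  have hle : ∀ i j : Fin n, i ≤ j → φ i = φ j → i = j := by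
    intro i j hij hφ
    have hmem : σ ^ ((j : ℕ) - i) ∈ E.fixingSubgroup := by
      rw [IntermediateField.mem_fixingSubgroup_iff]
      intro x hx
      have h1 : (σ ^ (i : ℕ)) x = (σ ^ (j : ℕ)) x := DFunLike.congr_fun hφ ⟨x, hx⟩
      have h2 : (σ ^ (j : ℕ)) x = (σ ^ (i : ℕ)) ((σ ^ ((j : ℕ) - i)) x) := by
        rw [← AlgEquiv.mul_apply, ← pow_add, Nat.add_sub_cancel' hij]
      exact ((σ ^ (i : ℕ)).injective (h1.trans h2)).symm
    have hdvd := (pow_mem_fixingSubgroup_iff σ hσ E _).1 hmem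
    rw [hE] at hdvd
    have h0 := Nat.eq_zero_of_dvd_of_lt hdvd (by omega)
    exact Fin.ext (by have : (i : ℕ) ≤ j := hij; omega)
  have hinj : Function.Injective φ := by
    intro i j hφ
    rcases le_total i j with hij | hij
    · exact hle i j hij hφ
    · exact (hle j i hij hφ.symm).symm
  have hli := (linearIndependent_monoidHom E K).comp φ hinj
  rw [Fintype.linearIndependent_iff] at hli ⊢
  intro c hc
  refine hli c ?_
  funext y
  let L : K →ₗ[F] K := ∑ j, c j • ((σ ^ (j : ℕ) : K ≃ₐ[F] K)).toLinearMap
  have hL : Submodule.span F (Set.range α) ≤ LinearMap.ker L := by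
    rw [Submodule.span_le]
    rintro _ ⟨x, rfl⟩
    have := congrFun hc x
    simpa [L, autOrbit] using this
  have hy : (y : K) ∈ LinearMap.ker L := hL (by rw [hspan]; exact y.2)
  simpa [L, φ] using hy

end AutomorphismOrbit

/-- The exponents `j < n` for which `σ^j(α)` lies in the `i`-th sum of a twisted Gabidulin
code. -/
def twistedExponents (n k t i : ℕ) : Finset ℕ :=
  (Finset.range n).filter fun j => j < k + i ∨ (k - 1 + t ≤ j ∧ j ≤ k - 1 + t + i)

theorem card_twistedExponents (n k t i : ℕ) :
    (twistedExponents n k t i).card =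
      min n (k + i) + (min n (k - 1 + t + i + 1) - max (k - 1 + t) (min n (k + i))) := by
  have heq : twistedExponents n k t i =
      Finset.range (min n (k + i)) ∪
        Finset.Ico (max (k - 1 + t) (min n (k + i))) (min n (k - 1 + t + i + 1)) := by
    ext j
    simp only [twistedExponents, Finset.mem_filter, Finset.mem_range, Finset.mem_union,
      Finset.mem_Ico]
    omega
  rw [heq, Finset.card_union_of_disjoint, Finset.card_range, Nat.card_Ico]
  rw [Finset.disjoint_left]
  intro j
  simp only [Finset.mem_range, Finset.mem_Ico]
  omega

theorem Sseq_twisted_eq_span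
    {F K : Type} [Field F] [Field K] [Algebra F K] {n : ℕ} (σ : K ≃ₐ[F] K) {α : Fin n → K}
    (hmod : ∀ j, autOrbit σ α (j % n) = autOrbit σ α j)
    {k h t : ℕ} (hkn : k < n) (hh1 : 1 ≤ h) (hh2 : h + 1 < k) (ht : t + k + 1 ≤ n)
    {η : K} (hη : η ≠ 0) {i : ℕ} (hi : 1 ≤ i) :
    Sseq σ (Submodule.span K
      ({v | ∃ j, j < k ∧ j ≠ h ∧ v = fun x => (σ ^ j) (α x)} ∪
        {fun x => (σ ^ h) (α x) + η * (σ ^ (k - 1 + t)) (α x)})) i =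
      Submodule.span K (autOrbit σ α '' (twistedExponents n k t i : Set ℕ)) := by
  set B := autOrbit σ α with hB
  set C := Submodule.span K
      ({v | ∃ j, j < k ∧ j ≠ h ∧ v = fun x => (σ ^ j) (α x)} ∪
        {fun x => (σ ^ h) (α x) + η * (σ ^ (k - 1 + t)) (α x)}) with hC
  have htwist : ∀ j, entrywiseMap n ((σ ^ j : K ≃ₐ[F] K) : K ≃+* K) (B h + η • B (k - 1 + t)) =
      B (j + h) + (σ ^ j) η • B (j + (k - 1 + t)) := by
    intro j
    rw [map_add, LinearMap.map_smulₛₗ, hB, entrywiseMap_autOrbit, entrywiseMap_autOrbit]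
    rfl
  apply le_antisymm
  · have hmem : ∀ l, (l < k + i ∨ (k - 1 + t ≤ l ∧ l ≤ k - 1 + t + i)) →
        B l ∈ Submodule.span K (B '' (twistedExponents n k t i : Set ℕ)) := by
      intro l hl
      rw [← hmod l]
      refine Submodule.subset_span ⟨l % n, ?_, rfl⟩
      simp only [twistedExponents, Finset.coe_filter, Set.mem_ofPred_eq, Finset.mem_range]
      refine ⟨Nat.mod_lt _ (by omega), ?_⟩
      rcases lt_or_ge l n with hln | hln
      · rwa [Nat.mod_eq_of_lt hln]
      · have h1 : l % n ≤ l - n := by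
          rw [Nat.mod_eq_sub_mod hln]; exact Nat.mod_le _ _
        omega
    refine Finset.sup_le fun j hj => ?_
    have hji : j ≤ i := Nat.lt_succ_iff.1 (Finset.mem_range.1 hj)
    rw [codeMap, hC, Submodule.map_span_le]
    rintro v (⟨l, hl, -, rfl⟩ | hv)
    · have := hmem (j + l) (by omega)
      rwa [hB, ← entrywiseMap_autOrbit] at this
    · obtain rfl : v = B h + η • B (k - 1 + t) := hv
      rw [htwist]
      exact add_mem (hmem _ (by omega)) (Submodule.smul_mem _ _ (hmem _ (by omega)))
  · have hgen : ∀ j l, j ≤ i → l < k → l ≠ h → B (j + l) ∈ Sseq σ C i := by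
      intro j l hj hl hlh
      rw [hB, ← entrywiseMap_autOrbit]
      exact entrywiseMap_mem_Sseq σ hj (Submodule.subset_span (Or.inl ⟨l, hl, hlh, rfl⟩))
    have hlow : ∀ l, l < k + i → B l ∈ Sseq σ C i := by
      intro l hl
      by_cases hlk : l < k
      · by_cases hlh : l = h
        · have := hgen 1 (h - 1) hi (by omega) (by omega)
          rwa [Nat.add_sub_cancel' hh1, ← hlh] at this
        · have := hgen 0 l (by omega) hlk hlh
          rwa [Nat.zero_add] at this
      · have := hgen (l - (k - 1)) (k - 1) (by omega) (by omega) (by omega)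
        rwa [Nat.sub_add_cancel (by omega)] at this
    rw [Submodule.span_le]
    rintro _ ⟨l, hl, rfl⟩
    simp only [twistedExponents, Finset.coe_filter, Set.mem_ofPred_eq, Finset.mem_range] at hl
    obtain ⟨-, hl | ⟨hl1, hl2⟩⟩ := hl
    · exact hlow l hl
    · obtain ⟨j, rfl⟩ := Nat.exists_eq_add_of_le' hl1
      have h1 : B (j + h) + (σ ^ j) η • B (j + (k - 1 + t)) ∈ Sseq σ C i := by
        rw [← htwist]
        exact entrywiseMap_mem_Sseq σ (by omega) (Submodule.subset_span (Or.inr rfl))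
      have h2 := (Submodule.add_mem_iff_right _ (hlow (j + h) (by omega))).1 h1
      exact (Submodule.smul_mem_iff _ ((map_ne_zero _).2 hη)).1 h2

/-- the dimension sequence of a (generalized) twisted Gabidulin
code with one twist, `t ∉ {1, n−k}`, `h ∉ {0, k−1}`, where the entries of `α`
form an `F`-basis of the subfield of `K` of degree `n`. -/
theorem twisted_gabidulin_sseq
    {F K : Type} [Field F] [Field K] [Algebra F K] [Fintype F] [Fintype K]
    (m n : ℕ) (hm : Module.finrank F K = m) (hdvd : n ∣ m)
    (σ : K ≃ₐ[F] K) (hσ : ∀ τ : K ≃ₐ[F] K, τ ∈ Subgroup.zpowers σ)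
    (α : Fin n → K) (hα : LinearIndependent F α)
    (E : IntermediateField F K) (hE : Module.finrank F E = n)
    (hspan : Submodule.span F (Set.range α) = Subalgebra.toSubmodule E.toSubalgebra)
    (k : ℕ) (hk1 : 1 ≤ k) (hkn : k < n)
    (h t : ℕ) (hh1 : 1 ≤ h) (hh2 : h + 1 < k)
    (ht1 : 2 ≤ t) (ht2 : t + k + 1 ≤ n)
    (η : K) (hη : η ≠ 0)
    (C : Submodule K (Fin n → K))
    (hC : C = Submodule.span K
      ({v | ∃ j, j < k ∧ j ≠ h ∧ v = fun x => (σ ^ j) (α x)} ∪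
        {fun x => (σ ^ h) (α x) + η * (σ ^ (k - 1 + t)) (α x)}))
    (M : ℕ) (hM : M = min (t - 1) (n - k - t)) :
    (∀ i, 1 ≤ i → i ≤ M → sseq σ C i = k + 1 + 2 * i) ∧
    (∀ i, M < i → sseq σ C i = min (k + 1 + M + i) n) := by
  have hαE : ∀ x, α x ∈ E := fun x => by
    have : α x ∈ Submodule.span F (Set.range α) := Submodule.subset_span ⟨x, rfl⟩
    rwa [hspan] at this
  have hli := linearIndependent_autOrbit σ hσ E hE hspan
  have hdim : ∀ i, 1 ≤ i → sseq σ C i = (twistedExponents n k t i).card := by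
    intro i hi
    rw [sseq, hC, Sseq_twisted_eq_span σ (autOrbit_mod σ hσ E hE hαE) hkn hh1 hh2 ht2 hη hi]
    have hlt : ∀ j : (twistedExponents n k t i : Set ℕ), (j : ℕ) < n := fun j =>
      Finset.mem_range.1 (Finset.mem_filter.1 j.2).1
    have hli' := hli.comp (fun j : (twistedExponents n k t i : Set ℕ) => (⟨j, hlt j⟩ : Fin n))
      (fun a b hab => Subtype.ext (Fin.mk.inj_iff.1 hab))
    have hcard := finrank_span_eq_card hli'
    rw [Set.image_eq_range]
    refine hcard.trans ?_
    simp
  constructor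
  · intro i hi hiM
    rw [hdim i hi, card_twistedExponents]
    omega
  · intro i hi
    rw [hdim i (by omega), card_twistedExponents]
    omega
end
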